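/- arXiv:2410.14653 — 4 statements merged into one kernel-verified Lean document; each statement's English description precedes it below -/
import Mathlib

section
/- Let W ⊂ GL(V) be a finite reflection group preserving a lattice M ⊂ V, and let D be the fundamental domain associated to a simple system Δ ⊂ M for W. Then there is an isomorphism of ℤ-algebras ℤ[D ∩ M] ≅ ℤ[M]^W between the semigroup algebra of the saturated semigroup D ∩ M and the ring of W-invariants of the group algebra ℤ[M]. -/
open scoped RealInnerProductSpace

noncomputable section

variable {V : Type*} [NormedAddCommGroup V] [InnerProductSpace ℝ V]

/-- `g` is the orthogonal reflection in the nonzero vector `α`: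
`g v = v - 2 (⟪v,α⟫/⟪α,α⟫) α`. -/
def IsReflectionBy (g : V ≃ₗ[ℝ] V) (α : V) : Prop :=
  α ≠ 0 ∧ ∀ v : V, g v = v - (2 * ⟪v, α⟫ / ⟪α, α⟫) • α

/-- A reflection group is a subgroup generated by the reflections it contains. -/
def IsReflectionGroup (W : Subgroup (V ≃ₗ[ℝ] V)) : Prop :=
  Subgroup.closure {g | g ∈ W ∧ ∃ α : V, IsReflectionBy g α} = W

/-- `Δ` is a simple system for `W`: a linearly independent subset of a root system `Φ`
whose reflections generate `W`, such that every root is a linear combination of `Δ`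
with coefficients all of the same sign. -/
def IsSimpleSystem (W : Subgroup (V ≃ₗ[ℝ] V)) {r : ℕ} (Δ : Fin r → V) : Prop :=
  LinearIndependent ℝ Δ ∧
  ∃ Φ : Finset V,
    (0 : V) ∉ Φ ∧
    (∀ α ∈ Φ, ∀ β ∈ Φ, (∃ c : ℝ, β = c • α) → β = α ∨ β = -α) ∧
    (∀ α ∈ Φ, ∀ β ∈ Φ, β - (2 * ⟪β, α⟫ / ⟪α, α⟫) • α ∈ Φ) ∧
    Subgroup.closure {g : V ≃ₗ[ℝ] V | ∃ α ∈ Φ, IsReflectionBy g α} = W ∧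
    (∀ i, Δ i ∈ Φ) ∧
    (∀ α ∈ Φ, (∃ c : Fin r → ℝ, (∀ i, 0 ≤ c i) ∧ α = ∑ i, c i • Δ i) ∨
              (∃ c : Fin r → ℝ, (∀ i, c i ≤ 0) ∧ α = ∑ i, c i • Δ i))

/-- The fundamental domain `D = {v : ⟪v, αᵢ⟫ ≥ 0 for all i}` of a simple system. -/
def fundDomain {r : ℕ} (Δ : Fin r → V) : Set V := {v | ∀ i, 0 ≤ ⟪v, Δ i⟫}

/-- A lattice in `V` is the ℤ-span of an ℝ-basis of `V`. -/
def IsLattice (M : Submodule ℤ V) : Prop :=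
  ∃ b : Set V, LinearIndependent ℝ ((↑) : b → V) ∧ Submodule.span ℝ b = ⊤ ∧
    Submodule.span ℤ b = M

/-- The weight group `Λ = {v : 2⟪v,αᵢ⟫/⟪αᵢ,αᵢ⟫ ∈ ℤ for all i}` of a simple system. -/
def weightGroup {r : ℕ} (Δ : Fin r → V) : Set V :=
  {v | ∀ i, ∃ n : ℤ, 2 * ⟪v, Δ i⟫ / ⟪Δ i, Δ i⟫ = (n : ℝ)}

/-- `lam` are the fundamental weights of the simple system `Δ`:
`2⟪λᵢ,αⱼ⟫/⟪αⱼ,αⱼ⟫ = δᵢⱼ` and `λᵢ ∈ (∩ₖ αₖ^⊥)^⊥`. -/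
def IsFundamentalWeights {r : ℕ} (Δ lam : Fin r → V) : Prop :=
  (∀ i j, 2 * ⟪lam i, Δ j⟫ / ⟪Δ j, Δ j⟫ = if i = j then 1 else 0) ∧
  ∀ i, lam i ∈ (⨅ k, (Submodule.span ℝ {Δ k})ᗮ)ᗮ

/-- The semigroup algebra `ℤ[S]` of a subset `S` (closed under `+`, containing `0`)
of an additive monoid `G`, as a subalgebra of the monoid algebra of `G`:
the subalgebra spanned by the characters `χˢ`, `s ∈ S`. -/
def semigroupAlg {G : Type*} [AddCommMonoid G] (S : Set G) :
    Subalgebra ℤ (AddMonoidAlgebra ℤ G) :=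
  Algebra.adjoin ℤ {f | ∃ s ∈ S, f = AddMonoidAlgebra.single s 1}

/-- The action of a linear automorphism `w` on the group algebra, `χᵛ ↦ χ^{w v}`. -/
def algAut (w : V ≃ₗ[ℝ] V) : AddMonoidAlgebra ℤ V ≃ₐ[ℤ] AddMonoidAlgebra ℤ V :=
  AddMonoidAlgebra.domCongr ℤ ℤ w.toAddEquiv

/-- The subalgebra of `W`-invariants of the group algebra `ℤ[V]`. -/
def fixedSubalgebra (W : Subgroup (V ≃ₗ[ℝ] V)) : Subalgebra ℤ (AddMonoidAlgebra ℤ V) where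
  carrier := {f | ∀ w ∈ W, algAut w f = f}
  mul_mem' := fun ha hb w hw => by rw [map_mul, ha w hw, hb w hw]
  one_mem' := fun w hw => map_one _
  add_mem' := fun ha hb w hw => by rw [map_add, ha w hw, hb w hw]
  zero_mem' := fun w hw => map_zero _
  algebraMap_mem' := fun r w hw => AlgEquiv.commutes _ r

open scoped Classical in
/-- The orbit sum `χ̲ᵘ = ∑_{v ∈ Wu} χᵛ`. -/
def orbitSum (W : Subgroup (V ≃ₗ[ℝ] V)) [Fintype W] (u : V) : AddMonoidAlgebra ℤ V :=
  ∑ v ∈ Finset.image (fun w : W => (w : V ≃ₗ[ℝ] V) u) Finset.univ,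
    AddMonoidAlgebra.single v 1

end

namespace LQT

section Roots

variable {V : Type*} [NormedAddCommGroup V] [InnerProductSpace ℝ V]

/-- reflection in `α` -/
noncomputable def refl (α : V) : V ≃ₗ[ℝ] V :=
  LinearEquiv.ofInvolutive
    ({ toFun := fun v => v - (2 * ⟪v, α⟫ / ⟪α, α⟫) • α
       map_add' := by
        intro x y
        rw [inner_add_left, mul_add, add_div, add_smul]; abel
       map_smul' := by
        intro c x
        rw [real_inner_smul_left, RingHom.id_apply, smul_sub, smul_smul]
        congr 2; ring } : V →ₗ[ℝ] V)
    (by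
      intro v
      by_cases h : α = 0
      · simp [h]
      have h' : ⟪α, α⟫ ≠ 0 := by simpa using h
      simp only [LinearMap.coe_mk, AddHom.coe_mk, inner_sub_left, real_inner_smul_left]
      rw [sub_sub, ← add_smul, div_mul_cancel₀ _ h']
      rw [sub_eq_self]
      convert zero_smul ℝ α using 2
      ring)

lemma refl_apply (α v : V) : refl α v = v - (2 * ⟪v, α⟫ / ⟪α, α⟫) • α := rfl

lemma refl_refl (α v : V) : refl α (refl α v) = v :=
  (LinearEquiv.ofInvolutive _ _).left_inv v

lemma refl_mul_self (α : V) : refl α * refl α = 1 := by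
  ext v; exact refl_refl α v

lemma refl_inv (α : V) : (refl α)⁻¹ = refl α := inv_eq_of_mul_eq_one_left (refl_mul_self α)

lemma refl_inner (α x y : V) : ⟪refl α x, refl α y⟫ = ⟪x, y⟫ := by
  by_cases h : α = 0
  · simp [refl_apply, h]
  have h' : ⟪α, α⟫ ≠ 0 := by simpa using h
  simp only [refl_apply, inner_sub_left, inner_sub_right, real_inner_smul_left,
    real_inner_smul_right, real_inner_comm α y]
  field_simp
  ring

lemma refl_smul (α : V) (c : ℝ) (hc : c ≠ 0) : refl (c • α) = refl α := by
  by_cases h : α = 0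
  · simp [h]
  have h' : ⟪α, α⟫ ≠ 0 := by simpa using h
  ext v
  simp only [refl_apply, real_inner_smul_left, real_inner_smul_right, smul_smul]
  congr 2
  field_simp

lemma refl_map (g : V ≃ₗ[ℝ] V) (hg : ∀ x y, ⟪g x, g y⟫ = ⟪x, y⟫) (α : V) :
    refl (g α) = g * refl α * g⁻¹ := by
  ext v
  obtain ⟨u, rfl⟩ := g.surjective v
  have : g⁻¹ (g u) = u := g.symm_apply_apply u
  simp only [LinearEquiv.mul_apply, this, refl_apply, hg, map_sub, map_smul]

lemma refl_self (α : V) : refl α α = -α := by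
  by_cases h : α = 0
  · simp [h]
  have h' : ⟪α, α⟫ ≠ 0 := by simpa using h
  rw [refl_apply, mul_div_assoc, div_self h', mul_one, two_smul]; abel

lemma isRefl_eq {g : V ≃ₗ[ℝ] V} {α : V} (h : IsReflectionBy g α) : g = refl α := by
  ext v; rw [h.2 v, refl_apply]

/-- the cone -/
def cone {r : ℕ} (Δ : Fin r → V) : AddSubmonoid V where
  carrier := {v | ∃ c : Fin r → ℝ, (∀ i, 0 ≤ c i) ∧ v = ∑ i, c i • Δ i}
  zero_mem' := ⟨0, by simp, by simp⟩
  add_mem' := by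
    rintro _ _ ⟨c, hc, rfl⟩ ⟨d, hd, rfl⟩
    exact ⟨c + d, fun i => add_nonneg (hc i) (hd i), by
      simp [add_smul, Finset.sum_add_distrib]⟩

variable {r : ℕ} {Δ : Fin r → V}

lemma cone_smul {c : ℝ} (hc : 0 ≤ c) {v : V} (hv : v ∈ cone Δ) : c • v ∈ cone Δ := by
  obtain ⟨d, hd, rfl⟩ := hv
  exact ⟨fun i => c * d i, fun i => mul_nonneg hc (hd i), by simp [Finset.smul_sum, smul_smul]⟩

lemma mem_cone (i : Fin r) : Δ i ∈ cone Δ :=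
  ⟨Pi.single i 1, fun j => by by_cases h : j = i <;> simp [Pi.single_apply, h], by
    simp [Pi.single_apply, ite_smul]⟩

lemma lin_eq (hl : LinearIndependent ℝ Δ) {c : Fin r → ℝ} (h : ∑ i, c i • Δ i = 0) : ∀ i, c i = 0 :=
  fun i => Fintype.linearIndependent_iff.1 hl c h i

lemma cone_antisymm (hl : LinearIndependent ℝ Δ) {v : V} (h : v ∈ cone Δ) (h' : -v ∈ cone Δ) :
    v = 0 := by
  obtain ⟨c, hc, h1⟩ := h
  obtain ⟨d, hd, h2⟩ := h'
  have h3 : ∑ i, (c i + d i) • Δ i = 0 := by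
    simp only [add_smul, Finset.sum_add_distrib, ← h1, ← h2, add_neg_cancel]
  have h4 := lin_eq hl h3
  rw [h1]
  refine Finset.sum_eq_zero fun i _ => ?_
  have : c i = 0 := by linarith [h4 i, hc i, hd i]
  simp [this]

lemma inner_cone {x v : V} (hx : x ∈ fundDomain Δ) (hv : v ∈ cone Δ) : 0 ≤ ⟪x, v⟫ := by
  obtain ⟨c, hc, rfl⟩ := hv
  rw [inner_sum]
  refine Finset.sum_nonneg fun i _ => ?_
  rw [real_inner_smul_right]
  exact mul_nonneg (hc i) (hx i)

/-- data -/
structure RS (Φ : Finset V) (Δ : Fin r → V) : Prop where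
  lin : LinearIndependent ℝ Δ
  zero : (0 : V) ∉ Φ
  cl : ∀ α ∈ Φ, ∀ β ∈ Φ, refl α β ∈ Φ
  mem : ∀ i, Δ i ∈ Φ
  sgn : ∀ α ∈ Φ, α ∈ cone Δ ∨ -α ∈ cone Δ

variable {Φ : Finset V} (H : RS Φ Δ)
include H

lemma RS.ne (i : Fin r) : Δ i ≠ 0 := fun h => H.zero (h ▸ H.mem i)

lemma RS.perm {β : V} (hβ : β ∈ Φ) (hc : β ∈ cone Δ) (i : Fin r) :
    refl (Δ i) β ∈ cone Δ ∨ ∃ c : ℝ, c ≠ 0 ∧ β = c • Δ i := by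
  rcases H.sgn _ (H.cl _ (H.mem i) _ hβ) with h | h
  · exact Or.inl h
  right
  obtain ⟨c, hc, h1⟩ := hc
  obtain ⟨d, hd, h2⟩ := h
  set k := 2 * ⟪β, Δ i⟫ / ⟪Δ i, Δ i⟫ with hk
  have h3 : ∑ j, (c j - (Pi.single i k : Fin r → ℝ) j + d j) • Δ j = 0 := by
    simp only [add_smul, sub_smul, Finset.sum_add_distrib, Finset.sum_sub_distrib, ← h1, ← h2]
    rw [refl_apply, ← hk]
    simp [Pi.single_apply, ite_smul]
  have h4 := lin_eq H.lin h3
  have h5 : β = c i • Δ i := by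
    rw [h1]
    refine Finset.sum_eq_single i (fun j _ hj => ?_) (by simp)
    have := h4 j
    simp only [Pi.single_apply, hj, if_false] at this
    have : c j = 0 := by linarith [hc j, hd j]
    simp [this]
  refine ⟨c i, ?_, h5⟩
  intro h0
  rw [h0, zero_smul] at h5
  exact H.zero (h5 ▸ hβ)

/-- word -/
noncomputable def word {r : ℕ} (Δ : Fin r → V) (l : List (Fin r)) : V ≃ₗ[ℝ] V :=
  (l.map fun i => refl (Δ i)).prod

omit H in
lemma word_inner (l : List (Fin r)) (x y : V) : ⟪word Δ l x, word Δ l y⟫ = ⟪x, y⟫ := by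
  induction l with
  | nil => simp [word]
  | cons i l ih =>
    simp only [word, List.map_cons, List.prod_cons, LinearEquiv.mul_apply] at ih ⊢
    rw [refl_inner, ih]

omit H in
lemma word_cons (i : Fin r) (l : List (Fin r)) : word Δ (i :: l) = refl (Δ i) * word Δ l := by
  simp [word]

omit H in
lemma word_concat (i : Fin r) (l : List (Fin r)) : word Δ (l ++ [i]) = word Δ l * refl (Δ i) := by
  simp [word]

lemma RS.word_mem (l : List (Fin r)) {β : V} (hβ : β ∈ Φ) : word Δ l β ∈ Φ := by
  induction l with
  | nil => simpa [word] using hβ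
  | cons i l ih => rw [word_cons]; exact H.cl _ (H.mem i) _ ih

lemma RS.exchange (i : Fin r) (l : List (Fin r)) :
    word Δ l (Δ i) ∈ cone Δ ∨ ∃ l', l'.length + 1 = l.length ∧
      word Δ l' = word Δ l * refl (Δ i) := by
  induction l with
  | nil => left; simpa [word] using mem_cone i
  | cons a l ih =>
    rcases ih with h | ⟨l', h1, h2⟩
    · rcases H.perm (H.word_mem l (H.mem i)) h a with h | ⟨c, hc, h⟩
      · left; rw [word_cons]; exact h
      · right
        refine ⟨l, by simp, ?_⟩
        have e1 := refl_map (word Δ l) (word_inner l) (Δ i)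
        rw [h, refl_smul _ _ hc] at e1
        rw [word_cons, e1]
        simp [mul_assoc, refl_mul_self]
    · right
      exact ⟨a :: l', by simp [h1], by rw [word_cons, word_cons, h2, mul_assoc]⟩

lemma RS.word_fund (n : ℕ) : ∀ l : List (Fin r), l.length = n → ∀ x ∈ fundDomain Δ,
    x - word Δ l x ∈ cone Δ := by
  induction n using Nat.strong_induction_on with
  | _ n ih =>
    intro l hl x hx
    rcases List.eq_nil_or_concat l with rfl | ⟨l, i, rfl⟩
    · simpa [word] using (cone Δ).zero_mem
    simp only [List.concat_eq_append, List.length_append, List.length_singleton] at hl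
    rw [List.concat_eq_append, word_concat]
    rcases H.exchange i l with h | ⟨l', h1, h2⟩
    · have e : x - (word Δ l * refl (Δ i)) x =
        (x - word Δ l x) + (2 * ⟪x, Δ i⟫ / ⟪Δ i, Δ i⟫) • word Δ l (Δ i) := by
        rw [LinearEquiv.mul_apply, refl_apply, map_sub, map_smul]; abel
      rw [e]
      refine (cone Δ).add_mem (ih l.length (by omega) l rfl x hx) (cone_smul ?_ h)
      exact div_nonneg (mul_nonneg zero_le_two (hx i)) real_inner_self_nonneg
    · rw [← h2]
      exact ih l'.length (by omega) l' rfl x hx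

lemma RS.refl_mem (ρ : V) (hρ : ∀ i, 0 < ⟪Δ i, ρ⟫) {β : V} (hβ : β ∈ Φ) :
    refl β ∈ Subgroup.closure (Set.range fun i => refl (Δ i)) := by
  classical
  suffices h : ∀ β ∈ Φ, β ∈ cone Δ → refl β ∈ Subgroup.closure (Set.range fun i => refl (Δ i)) by
    rcases H.sgn β hβ with h1 | h1
    · exact h β hβ h1
    · have e : refl (-β) = refl β := by
        rw [← neg_one_smul ℝ β]; exact refl_smul β (-1) (by norm_num)
      rw [← e]
      refine h _ ?_ h1
      rw [← refl_self]; exact H.cl _ hβ _ hβ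
  by_contra hcon
  push Not at hcon
  obtain ⟨β₀, hb1, hb2, hb3⟩ := hcon
  obtain ⟨β, hB, hmin⟩ := Finset.exists_min_image
    (Φ.filter fun β => β ∈ cone Δ ∧ refl β ∉ Subgroup.closure (Set.range fun i => refl (Δ i)))
    (fun β => ⟪β, ρ⟫) ⟨β₀, by simp [hb1, hb2, hb3]⟩
  simp only [Finset.mem_filter] at hB hmin
  obtain ⟨hβΦ, hβc, hβn⟩ := hB
  obtain ⟨c, hc, h1⟩ := id hβc
  have hpos : 0 < ⟪β, β⟫ := by
    refine lt_of_le_of_ne real_inner_self_nonneg (Ne.symm ?_)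
    rw [Ne, inner_self_eq_zero]; rintro rfl; exact H.zero hβΦ
  have h2 : ⟪β, β⟫ = ∑ i, c i * ⟪β, Δ i⟫ := by
    nth_rewrite 2 [h1]
    simp [inner_sum, real_inner_smul_right]
  rw [h2] at hpos
  obtain ⟨i, -, hi⟩ := Finset.exists_lt_of_sum_lt (s := Finset.univ) (f := fun _ : Fin r => (0:ℝ))
    (g := fun i => c i * ⟪β, Δ i⟫) (by simpa using hpos)
  have hi2 : 0 < ⟪β, Δ i⟫ := pos_of_mul_pos_right hi (hc i)
  have hsi : refl (Δ i) ∈ Subgroup.closure (Set.range fun i => refl (Δ i)) :=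
    Subgroup.subset_closure ⟨i, rfl⟩
  rcases H.perm hβΦ hβc i with h | ⟨d, hd, h⟩
  · have hγ : refl (refl (Δ i) β) ∈ Subgroup.closure (Set.range fun i => refl (Δ i)) := by
      by_contra hn
      have := hmin (refl (Δ i) β) ⟨H.cl _ (H.mem i) _ hβΦ, h, hn⟩
      rw [refl_apply, inner_sub_left, real_inner_smul_left] at this
      have h0 : 0 < ⟪Δ i, Δ i⟫ := by
        refine lt_of_le_of_ne real_inner_self_nonneg (Ne.symm ?_)
        rw [Ne, inner_self_eq_zero]; exact H.ne i
      have : 0 < 2 * ⟪β, Δ i⟫ / ⟪Δ i, Δ i⟫ * ⟪Δ i, ρ⟫ := by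
        have := hρ i; positivity
      linarith
    apply hβn
    have e := refl_map (refl (Δ i)) (refl_inner _) (refl (Δ i) β)
    rw [refl_refl] at e
    rw [e]
    exact mul_mem (mul_mem hsi hγ) (inv_mem hsi)
  · apply hβn
    rw [h, refl_smul _ _ hd]
    exact hsi

omit H in
lemma closure_word {w : V ≃ₗ[ℝ] V}
    (hw : w ∈ Subgroup.closure (Set.range fun i => refl (Δ i))) : ∃ l, w = word Δ l := by
  induction hw using Subgroup.closure_induction with
  | mem x hx => obtain ⟨i, rfl⟩ := hx; exact ⟨[i], by simp [word]⟩
  | one => exact ⟨[], by simp [word]⟩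
  | mul x y _ _ hx hy =>
    obtain ⟨l, rfl⟩ := hx
    obtain ⟨l', rfl⟩ := hy
    exact ⟨l ++ l', by simp [word]⟩
  | inv x _ hx =>
    obtain ⟨l, rfl⟩ := hx
    refine ⟨l.reverse, ?_⟩
    simp only [word, List.prod_inv_reverse, List.map_reverse, List.map_map]
    congr 3

omit H in
lemma exists_dual [FiniteDimensional ℝ V] (hl : LinearIndependent ℝ Δ) :
    ∃ μ : Fin r → V, ∀ i j, ⟪μ i, Δ j⟫ = if i = j then 1 else 0 := by
  have hi : LinearMap.ker (Fintype.linearCombination ℝ Δ) = ⊥ := by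
    rw [LinearMap.ker_eq_bot']
    intro c hc
    ext i
    exact lin_eq hl (by simpa [Fintype.linearCombination_apply] using hc) i
  obtain ⟨g, hg⟩ := LinearMap.exists_leftInverse_of_injective _ hi
  refine ⟨fun i => (InnerProductSpace.toDual ℝ V).symm
    (LinearMap.toContinuousLinearMap ((LinearMap.proj i).comp g)), fun i j => ?_⟩
  rw [InnerProductSpace.toDual_symm_apply]
  have := LinearMap.congr_fun hg (Pi.single j 1)
  simp at this
  simp [this, Pi.single_apply]

end Roots

end LQT

namespace LQT

section Alg

variable {V : Type*} [NormedAddCommGroup V] [InnerProductSpace ℝ V]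

lemma algAut_coeff (w : V ≃ₗ[ℝ] V) (f : AddMonoidAlgebra ℤ V) (v : V) :
    (algAut w f).coeff (w v) = f.coeff v := by
  change (Finsupp.mapDomain w f.coeff) (w v) = _
  exact Finsupp.mapDomain_apply w.injective _ _

lemma mem_fixed (W : Subgroup (V ≃ₗ[ℝ] V)) (f : AddMonoidAlgebra ℤ V) :
    f ∈ fixedSubalgebra W ↔ ∀ w ∈ W, ∀ v, f.coeff (w v) = f.coeff v := by
  constructor
  · intro h w hw v
    have := h w hw
    conv_lhs => rw [← this]
    exact algAut_coeff w f v
  · intro h w hw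
    ext v
    obtain ⟨u, rfl⟩ := w.surjective v
    rw [algAut_coeff, h w hw]

lemma mem_semigroupAlg (N : AddSubmonoid V) (f : AddMonoidAlgebra ℤ V) :
    f ∈ semigroupAlg (N : Set V) ↔ ∀ u, f.coeff u ≠ 0 → u ∈ N := by
  classical
  constructor
  · intro h
    unfold semigroupAlg at h
    induction h using Algebra.adjoin_induction with
    | mem x hx =>
      obtain ⟨s, hs, rfl⟩ := hx
      intro u hu
      by_cases e : s = u
      · exact e ▸ hs
      · simp [AddMonoidAlgebra.coeff_single, e] at hu
    | algebraMap z =>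
      intro u hu
      by_cases e : 0 = u
      · exact e ▸ N.zero_mem
      · rw [AddMonoidAlgebra.coe_algebraMap] at hu
        simp [AddMonoidAlgebra.coeff_single, e] at hu
    | add x y _ _ hx hy =>
      intro u hu
      by_cases e : x.coeff u = 0
      · exact hy u (fun e' => hu (by simp [e, e']))
      · exact hx u e
    | mul x y _ _ hx hy =>
      intro u hu
      have := AddMonoidAlgebra.support_coeff_mul_subset _ _ (Finsupp.mem_support_iff.2 hu)
      obtain ⟨a, ha, b, hb, rfl⟩ := Finset.mem_add.1 this
      exact N.add_mem (hx a (Finsupp.mem_support_iff.1 ha)) (hy b (Finsupp.mem_support_iff.1 hb))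
  · intro h
    refine Algebra.adjoin_mono ?_ (AddMonoidAlgebra.mem_adjoin_support f)
    rintro _ ⟨u, hu, rfl⟩
    exact ⟨u, h u (Finsupp.mem_support_iff.1 hu), rfl⟩

lemma range_incl (N : AddSubmonoid V) :
    (AddMonoidAlgebra.mapDomainAlgHom ℤ ℤ N.subtype).range = semigroupAlg (N : Set V) := by
  apply le_antisymm
  · rintro _ ⟨f, rfl⟩
    induction f using AddMonoidAlgebra.induction_linear with
    | zero => rw [map_zero]; exact Subalgebra.zero_mem _
    | add x y hx hy => rw [map_add]; exact Subalgebra.add_mem _ hx hy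
    | single a b =>
      rw [mem_semigroupAlg]
      intro u hu
      by_cases e : (a : V) = u
      · exact e ▸ a.2
      · simp [AddMonoidAlgebra.coeff_single, e] at hu
  · refine Algebra.adjoin_le ?_
    rintro _ ⟨s, hs, rfl⟩
    exact ⟨AddMonoidAlgebra.single ⟨s, hs⟩ 1, by simp⟩

variable {r : ℕ}

/-- leading term condition -/
structure Lead (W : Subgroup (V ≃ₗ[ℝ] V)) (M : Submodule ℤ V) (Δ : Fin r → V) (m : V)
    (f : AddMonoidAlgebra ℤ V) : Prop where
  one : f.coeff m = 1
  le : ∀ u, f.coeff u ≠ 0 → m - u ∈ cone Δ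
  lat : ∀ u, f.coeff u ≠ 0 → m - u ∈ M
  inv : f ∈ fixedSubalgebra W

variable {W : Subgroup (V ≃ₗ[ℝ] V)} {M : Submodule ℤ V} {Δ : Fin r → V}

lemma Lead.mul (hl : LinearIndependent ℝ Δ) {m n : V} {f g : AddMonoidAlgebra ℤ V}
    (hf : Lead W M Δ m f) (hg : Lead W M Δ n g) : Lead W M Δ (m + n) (f * g) := by
  classical
  have key : ∀ u, (f * g).coeff u ≠ 0 → ∃ a b, f.coeff a ≠ 0 ∧ g.coeff b ≠ 0 ∧ a + b = u := by
    intro u hu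
    have := AddMonoidAlgebra.support_coeff_mul_subset _ _ (Finsupp.mem_support_iff.2 hu)
    obtain ⟨a, ha, b, hb, rfl⟩ := Finset.mem_add.1 this
    exact ⟨a, b, Finsupp.mem_support_iff.1 ha, Finsupp.mem_support_iff.1 hb, rfl⟩
  refine ⟨?_, ?_, ?_, Subalgebra.mul_mem _ hf.inv hg.inv⟩
  · rw [AddMonoidAlgebra.coeff_mul_add_of_uniqueAdd, hf.one, hg.one, mul_one]
    intro a b ha hb hab
    have h1 := hf.le a (Finsupp.mem_support_iff.1 ha)
    have h2 := hg.le b (Finsupp.mem_support_iff.1 hb)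
    have e : n - b = -(m - a) := by
      rw [neg_sub, sub_eq_sub_iff_add_eq_add, hab, add_comm]
    rw [e] at h2
    have h3 := cone_antisymm hl h1 h2
    rw [h3, neg_zero] at e
    exact ⟨(sub_eq_zero.1 h3).symm, (sub_eq_zero.1 e).symm⟩
  · intro u hu
    obtain ⟨a, b, ha, hb, rfl⟩ := key u hu
    rw [add_sub_add_comm]
    exact (cone Δ).add_mem (hf.le a ha) (hg.le b hb)
  · intro u hu
    obtain ⟨a, b, ha, hb, rfl⟩ := key u hu
    rw [add_sub_add_comm]
    exact M.add_mem (hf.lat a ha) (hg.lat b hb)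

lemma Lead.single {m : V} (hm : ∀ w ∈ W, w m = m) :
    Lead W M Δ m (AddMonoidAlgebra.single m 1) := by
  classical
  have key : ∀ u, (AddMonoidAlgebra.single m (1 : ℤ)).coeff u ≠ 0 → m - u = 0 := by
    intro u hu
    by_contra e
    have e : m ≠ u := fun h => e (by simp [h])
    simp [AddMonoidAlgebra.coeff_single, e] at hu
  refine ⟨by simp, fun u hu => ?_, fun u hu => ?_, ?_⟩
  · rw [key u hu]; exact (cone Δ).zero_mem
  · rw [key u hu]; exact M.zero_mem
  · intro w hw
    simp [algAut, hm w hw]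

lemma Lead.pow (hl : LinearIndependent ℝ Δ) {m : V} {f : AddMonoidAlgebra ℤ V}
    (hf : Lead W M Δ m f) (n : ℕ) : Lead W M Δ (n • m) (f ^ n) := by
  induction n with
  | zero =>
    rw [zero_smul, pow_zero]
    exact Lead.single (fun w _ => map_zero w)
  | succ n ih => rw [succ_nsmul, pow_succ]; exact ih.mul hl hf

lemma Lead.prod (hl : LinearIndependent ℝ Δ) {ι : Type*} (s : Finset ι) {m : ι → V}
    {f : ι → AddMonoidAlgebra ℤ V} (hf : ∀ i, Lead W M Δ (m i) (f i)) :
    Lead W M Δ (∑ i ∈ s, m i) (∏ i ∈ s, f i) := by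
  classical
  induction s using Finset.induction_on with
  | empty => exact Lead.single (fun w _ => map_zero w)
  | insert a s ha ih => rw [Finset.sum_insert ha, Finset.prod_insert ha]; exact (hf a).mul hl ih

lemma Lead.orbit [Fintype W] {m : V} (h1 : ∀ w ∈ W, m - w m ∈ cone Δ)
    (h2 : ∀ w ∈ W, m - w m ∈ M) : Lead W M Δ m (orbitSum W m) := by
  classical
  have hc : ∀ v, (orbitSum W m).coeff v = if ∃ w ∈ W, w m = v then 1 else 0 := by
    intro v
    unfold orbitSum
    simp [AddMonoidAlgebra.coeff_sum, Finsupp.single_apply]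
  have key : ∀ u, (orbitSum W m).coeff u ≠ 0 → ∃ w ∈ W, w m = u := by
    intro u hu
    by_contra e
    exact hu (by rw [hc, if_neg e])
  refine ⟨?_, fun u hu => ?_, fun u hu => ?_, ?_⟩
  · rw [hc, if_pos ⟨1, W.one_mem, rfl⟩]
  · obtain ⟨w, hw, rfl⟩ := key u hu; exact h1 w hw
  · obtain ⟨w, hw, rfl⟩ := key u hu; exact h2 w hw
  · rw [mem_fixed]
    intro w hw v
    rw [hc, hc]
    congr 1
    refine propext ⟨?_, ?_⟩
    · rintro ⟨x, hx, h⟩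
      exact ⟨w⁻¹ * x, mul_mem (inv_mem hw) hx, by
        rw [LinearEquiv.mul_apply, h]; exact w.symm_apply_apply v⟩
    · rintro ⟨x, hx, rfl⟩
      exact ⟨w * x, mul_mem hw hx, rfl⟩

/-- abstract triangularity -/
lemma main_iso (hl : LinearIndependent ℝ Δ)
    (hin : ∀ w ∈ W, ∀ x y : V, ⟪w x, w y⟫ = ⟪x, y⟫)
    (hdom : ∀ u, ∃ w ∈ W, w u ∈ fundDomain Δ)
    (hWM : ∀ w ∈ W, ∀ m ∈ M, (w : V ≃ₗ[ℝ] V) m ∈ M)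
    (hfin : ∀ R : ℝ, {v : V | v ∈ M ∧ ‖v‖ ≤ R}.Finite)
    (N : AddSubmonoid V) (hN : (N : Set V) = fundDomain Δ ∩ (M : Set V))
    (F : Multiplicative N →* AddMonoidAlgebra ℤ V)
    (hF : ∀ m : N, Lead W M Δ m (F (Multiplicative.ofAdd m))) :
    Nonempty ((semigroupAlg (fundDomain Δ ∩ (M : Set V))) ≃ₐ[ℤ]
      ↥(semigroupAlg (M : Set V) ⊓ fixedSubalgebra W)) := by
  classical
  have hNmem : ∀ v, v ∈ N ↔ v ∈ fundDomain Δ ∧ v ∈ M := fun v => by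
    rw [← SetLike.mem_coe, hN]; rfl
  have hnorm : ∀ u m : V, u ∈ fundDomain Δ → m - u ∈ cone Δ → u ≠ m → ‖u‖ < ‖m‖ := by
    intro u m hu hm hne
    have h1 := inner_cone hu hm
    have h2 : ‖m‖ ^ 2 = ‖u‖ ^ 2 + 2 * ⟪u, m - u⟫ + ‖m - u‖ ^ 2 := by
      rw [← norm_add_sq_real]; simp
    have h3 : 0 < ‖m - u‖ := norm_pos_iff.2 (sub_ne_zero.2 (Ne.symm hne))
    have : ‖u‖ ^ 2 < ‖m‖ ^ 2 := by nlinarith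
    exact lt_of_pow_lt_pow_left₀ 2 (norm_nonneg _) this
  have hwn : ∀ w ∈ W, ∀ x : V, ‖w x‖ = ‖x‖ := by
    intro w hw x
    rw [norm_eq_sqrt_real_inner, hin w hw, ← norm_eq_sqrt_real_inner]
  let φ := AddMonoidAlgebra.lift ℤ (AddMonoidAlgebra ℤ V) N F
  have hφ : ∀ f, φ f = ∑ m ∈ f.coeff.support, f.coeff m • F (Multiplicative.ofAdd m) := by
    intro f
    simp only [φ, AddMonoidAlgebra.lift_apply]
    rfl
  have hφc : ∀ f u, (φ f).coeff u =
      ∑ m ∈ f.coeff.support, f.coeff m * (F (Multiplicative.ofAdd m)).coeff u := by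
    intro f u
    rw [hφ]
    simp only [AddMonoidAlgebra.coeff_sum, Finsupp.finsetSum_apply, AddMonoidAlgebra.coeff_smul,
      Finsupp.smul_apply, smul_eq_mul]
  -- key coefficient formula
  have hkey : ∀ (f : AddMonoidAlgebra ℤ N) (u : V), u ∈ fundDomain Δ →
      (∀ m ∈ f.coeff.support, ‖(m : V)‖ ≤ ‖u‖) →
      ∀ m ∈ f.coeff.support, (m : V) ≠ u → (F (Multiplicative.ofAdd m)).coeff u = 0 := by
    intro f u hu hle m hm hne
    by_contra h
    exact absurd (hnorm u m hu ((hF m).le u h) (Ne.symm hne)) (not_lt.2 (hle m hm))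
  have hinj : Function.Injective φ := by
    rw [injective_iff_map_eq_zero]
    intro f hf
    by_contra hne
    have hs : f.coeff.support.Nonempty := by
      rw [Finsupp.support_nonempty_iff]
      exact fun h => hne (AddMonoidAlgebra.coeff_eq_zero.1 h)
    obtain ⟨m, hm, hmax⟩ := Finset.exists_max_image _ (fun m : N => ‖(m : V)‖) hs
    have h1 := hφc f m
    rw [hf, Finset.sum_eq_single m, (hF m).one, mul_one] at h1
    · exact Finsupp.mem_support_iff.1 hm (by simpa using h1.symm)
    · intro b hb hbm
      rw [hkey f m ((hNmem m).1 m.2).1 hmax b hb (fun h => hbm (Subtype.ext h)), mul_zero]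
    · intro h; exact absurd hm h
  have hFmem : ∀ m : N, F (Multiplicative.ofAdd m) ∈ semigroupAlg (M : Set V) ⊓ fixedSubalgebra W := by
    intro m
    refine ⟨?_, (hF m).inv⟩
    refine (mem_semigroupAlg M.toAddSubmonoid _).2 fun u hu => ?_
    have h1 := (hF m).lat u hu
    have h2 := M.sub_mem ((hNmem m).1 m.2).2 h1
    simpa using h2
  have hφmem : ∀ f, φ f ∈ semigroupAlg (M : Set V) ⊓ fixedSubalgebra W := by
    intro f
    rw [hφ]
    exact Subalgebra.sum_mem _ fun m _ => Subalgebra.smul_mem _ (hFmem m) _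
  have hsurj : ∀ n : ℕ, ∀ R : ℝ, (hfin R).toFinset.card ≤ n →
      ∀ g ∈ semigroupAlg (M : Set V) ⊓ fixedSubalgebra W, (∀ u, g.coeff u ≠ 0 → ‖u‖ ≤ R) →
        g ∈ φ.range := by
    intro n
    induction n with
    | zero =>
      intro R hR g hg hgR
      have : g = 0 := by
        ext u
        by_contra h
        have hu : u ∈ (hfin R).toFinset := by
          simp only [Set.Finite.mem_toFinset, Set.mem_ofPred_eq]
          exact ⟨(mem_semigroupAlg M.toAddSubmonoid g).1 hg.1 u h, hgR u h⟩
        rw [Finset.card_eq_zero.1 (Nat.le_zero.1 hR)] at hu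
        simp at hu
      rw [this]; exact Subalgebra.zero_mem _
    | succ n ih =>
      intro R hR g hg hgR
      by_cases hs : g.coeff.support.Nonempty
      swap
      · have : g = 0 := by
          rw [Finset.not_nonempty_iff_eq_empty, Finsupp.support_eq_empty] at hs
          exact AddMonoidAlgebra.coeff_eq_zero.1 hs
        rw [this]; exact Subalgebra.zero_mem _
      obtain ⟨v, hv, hmax⟩ := Finset.exists_max_image _ (fun m : V => ‖m‖) hs
      have hgM := (mem_semigroupAlg M.toAddSubmonoid g).1 hg.1
      have hgW := (mem_fixed W g).1 hg.2
      let f : AddMonoidAlgebra ℤ N := .ofCoeff (g.coeff.comapDomain (fun m : N => (m : V))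
        Subtype.val_injective.injOn)
      have hfc : ∀ m : N, f.coeff m = g.coeff m := fun m => rfl
      have hg' : g - φ f ∈ semigroupAlg (M : Set V) ⊓ fixedSubalgebra W :=
        Subalgebra.sub_mem _ hg (hφmem f)
      have hfle : ∀ m ∈ f.coeff.support, ‖(m : V)‖ ≤ ‖v‖ := by
        intro m hm
        rw [Finsupp.mem_support_iff, hfc] at hm
        exact hmax m (Finsupp.mem_support_iff.2 hm)
      -- the difference has support in smaller norms
      have hlt : ∀ u, (g - φ f).coeff u ≠ 0 → ‖u‖ < ‖v‖ := by
        intro u hu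
        obtain ⟨w, hw, hwu⟩ := hdom u
        have hu' : (g - φ f).coeff (w u) ≠ 0 := by
          rwa [(mem_fixed W _).1 hg'.2 w hw]
        have huM : w u ∈ M := (mem_semigroupAlg M.toAddSubmonoid _).1 hg'.1 _ hu'
        rw [← hwn w hw u]
        generalize w u = x at hwu hu' huM
        by_contra hle
        rw [not_lt] at hle
        apply hu'
        have h1 := hkey f x hwu (fun m hm => (hfle m hm).trans hle)
        have hxN : x ∈ N := (hNmem x).2 ⟨hwu, huM⟩
        have h2 : (φ f).coeff x = g.coeff x := by
          rw [hφc, Finset.sum_eq_single (⟨x, hxN⟩ : N), hfc, (hF ⟨x, hxN⟩).one, mul_one]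
          · intro b hb hbm
            rw [h1 b hb (fun h => hbm (Subtype.ext h)), mul_zero]
          · intro h
            rw [Finsupp.notMem_support_iff.1 h, zero_mul]
        rw [AddMonoidAlgebra.coeff_sub, Finsupp.sub_apply, h2, sub_self]
      have hvM : v ∈ M := hgM v (Finsupp.mem_support_iff.1 hv)
      have hvR : ‖v‖ ≤ R := hgR v (Finsupp.mem_support_iff.1 hv)
      have hfin' := hφmem f
      have : g - φ f ∈ φ.range := by
        by_cases hs' : (g - φ f).coeff.support.Nonempty
        swap
        · have : g - φ f = 0 := by
            rw [Finset.not_nonempty_iff_eq_empty, Finsupp.support_eq_empty] at hs'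
            exact AddMonoidAlgebra.coeff_eq_zero.1 hs'
          rw [this]; exact Subalgebra.zero_mem _
        obtain ⟨v', hv', hmax'⟩ := Finset.exists_max_image _ (fun m : V => ‖m‖) hs'
        have hv'lt := hlt v' (Finsupp.mem_support_iff.1 hv')
        refine ih ‖v'‖ ?_ _ hg' (fun u hu => hmax' u (Finsupp.mem_support_iff.2 hu))
        have : (hfin ‖v'‖).toFinset ⊂ (hfin R).toFinset := by
          rw [Finset.ssubset_iff_of_subset]
          · refine ⟨v, ?_, ?_⟩
            · simp [hvM, hvR]
            · simp [hv'lt]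
          · intro x
            simp only [Set.Finite.mem_toFinset, Set.mem_ofPred_eq]
            exact fun h => ⟨h.1, by linarith [h.2]⟩
        have := Finset.card_lt_card this
        omega
      have h2 := Subalgebra.add_mem _ this (show φ f ∈ φ.range from ⟨f, rfl⟩)
      simpa using h2
  have hrange : φ.range = semigroupAlg (M : Set V) ⊓ fixedSubalgebra W := by
    apply le_antisymm
    · rintro _ ⟨f, rfl⟩; exact hφmem f
    · intro g hg
      obtain ⟨R, hR⟩ := (g.coeff.support.image (fun u => ‖u‖)).bddAbove
      refine hsurj _ R le_rfl g hg fun u hu => hR ?_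
      simp only [Finset.coe_image]
      exact ⟨u, Finsupp.mem_support_iff.2 hu, rfl⟩
  have hι : Function.Injective (AddMonoidAlgebra.mapDomainAlgHom ℤ ℤ N.subtype) :=
    AddMonoidAlgebra.mapDomain_injective Subtype.val_injective
  have e1 := AlgEquiv.ofInjective _ hι
  rw [range_incl, hN] at e1
  have e2 := AlgEquiv.ofInjective _ hinj
  rw [hrange] at e2
  exact ⟨e1.symm.trans e2⟩

end Alg

end LQT

namespace LQT

section Lat

variable {V : Type*} [NormedAddCommGroup V] [InnerProductSpace ℝ V]

lemma lattice_fin [FiniteDimensional ℝ V] {M : Submodule ℤ V} (hM : IsLattice M) (R : ℝ) :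
    {v : V | v ∈ M ∧ ‖v‖ ≤ R}.Finite := by
  obtain ⟨b, h1, h2, rfl⟩ := hM
  let B : Module.Basis b ℝ V := Module.Basis.mk h1 (by simp [h2])
  haveI : Finite b := Module.Finite.finite_basis B
  haveI : ProperSpace V := FiniteDimensional.proper ℝ V
  have := ZSpan.setFinite_inter B (Metric.isBounded_closedBall (x := (0 : V)) (r := R))
  refine this.subset ?_
  rintro v ⟨hv, hR⟩
  refine ⟨by simpa using hR, ?_⟩
  have e : Set.range B = b := by simp [B]
  rw [e]; exact hv

lemma exists_prim (M : Submodule ℤ V) (hfin : ∀ R : ℝ, {v : V | v ∈ M ∧ ‖v‖ ≤ R}.Finite)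
    {v : V} (hv : v ≠ 0) (hvM : v ∈ M) :
    ∃ d : ℝ, 0 < d ∧ d • v ∈ M ∧ ∀ c : ℝ, c • v ∈ M → ∃ n : ℤ, c = n * d := by
  have hf : {c : ℝ | 0 < c ∧ c ≤ 1 ∧ c • v ∈ M}.Finite := by
    refine Set.Finite.of_finite_image (f := fun c : ℝ => c • v) ((hfin ‖v‖).subset ?_)
      (fun a _ b _ h => smul_left_injective ℝ hv h)
    rintro _ ⟨c, ⟨h0, h1, h2⟩, rfl⟩
    refine ⟨h2, ?_⟩
    rw [norm_smul, Real.norm_eq_abs, abs_of_pos h0]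
    exact mul_le_of_le_one_left (norm_nonneg _) h1
  obtain ⟨d, ⟨hd0, hd1, hdM⟩, hmin⟩ := hf.exists_minimalFor id _
    ⟨1, by simpa using hvM⟩
  refine ⟨d, hd0, hdM, fun c hc => ⟨⌊c / d⌋, ?_⟩⟩
  by_contra hne
  have h1 : (⌊c / d⌋ : ℝ) * d ≤ c := (le_div_iff₀ hd0).1 (Int.floor_le _)
  have h2 : c < (⌊c / d⌋ + 1) * d := (div_lt_iff₀ hd0).1 (Int.lt_floor_add_one _)
  have h3 : (⌊c / d⌋ : ℝ) * d < c := lt_of_le_of_ne h1 (Ne.symm hne)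
  have h4 : (c - ⌊c / d⌋ * d) • v ∈ M := by
    rw [sub_smul, mul_smul, Int.cast_smul_eq_zsmul]
    exact M.sub_mem hc (M.smul_mem _ hdM)
  have h5 := hmin (j := c - ⌊c / d⌋ * d) ⟨by linarith, by linarith, h4⟩ (by simp only [id]; linarith)
  simp only [id] at h5
  linarith

end Lat

end LQT

theorem lattice_quotient_toric
    {V : Type*} [NormedAddCommGroup V] [InnerProductSpace ℝ V] [FiniteDimensional ℝ V]
    (W : Subgroup (V ≃ₗ[ℝ] V)) [Finite W] (hW : IsReflectionGroup W)
    (M : Submodule ℤ V) (hM : IsLattice M)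
    (hWM : ∀ w ∈ W, ∀ m ∈ M, (w : V ≃ₗ[ℝ] V) m ∈ M)
    {r : ℕ} (Δ : Fin r → V) (hΔ : IsSimpleSystem W Δ) (hΔM : ∀ i, Δ i ∈ M) :
    Nonempty ((semigroupAlg (fundDomain Δ ∩ (M : Set V))) ≃ₐ[ℤ]
      ↥(semigroupAlg (M : Set V) ⊓ fixedSubalgebra W)) := by
  classical
  obtain ⟨hl, Φ, h0, -, hcl, hgen, hmem, hsgn⟩ := hΔ
  have H : LQT.RS Φ Δ := by
    refine ⟨hl, h0, fun α hα β hβ => hcl α hα β hβ, hmem, fun α hα => ?_⟩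
    rcases hsgn α hα with h | ⟨c, hc, h⟩
    · exact Or.inl h
    · exact Or.inr ⟨fun i => - c i, fun i => neg_nonneg.2 (hc i), by simp [h]⟩
  obtain ⟨μ, hμ⟩ := LQT.exists_dual hl
  -- generation by simple reflections
  have hρ : ∀ i, 0 < ⟪Δ i, ∑ j, μ j⟫ := by
    intro i
    rw [real_inner_comm, sum_inner]
    simp [hμ]
  have hWle : W ≤ Subgroup.closure (Set.range fun i => LQT.refl (Δ i)) := by
    rw [← hgen, Subgroup.closure_le]
    rintro g ⟨α, hα, hg⟩
    rw [LQT.isRefl_eq hg]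
    exact H.refl_mem _ hρ hα
  have hsW : ∀ i, LQT.refl (Δ i) ∈ W := by
    intro i
    rw [← hgen]
    exact Subgroup.subset_closure ⟨Δ i, hmem i, H.ne i, fun v => rfl⟩
  have hword : ∀ w ∈ W, ∃ l, w = LQT.word Δ l := fun w hw => LQT.closure_word (hWle hw)
  have hin : ∀ w ∈ W, ∀ x y : V, ⟪w x, w y⟫ = ⟪x, y⟫ := by
    intro w hw x y
    obtain ⟨l, rfl⟩ := hword w hw
    exact LQT.word_inner l x y
  have hfund : ∀ x ∈ fundDomain Δ, ∀ w ∈ W, x - w x ∈ LQT.cone Δ := by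
    intro x hx w hw
    obtain ⟨l, rfl⟩ := hword w hw
    exact H.word_fund _ l rfl x hx
  have hpos : ∀ i, 0 < ⟪Δ i, Δ i⟫ := fun i => real_inner_self_pos.2 (H.ne i)
  have hdom : ∀ u, ∃ w ∈ W, w u ∈ fundDomain Δ := by
    intro u
    obtain ⟨w, hw⟩ := Finite.exists_max (fun w : W => ⟪(w : V ≃ₗ[ℝ] V) u, ∑ j, μ j⟫)
    refine ⟨w, w.2, fun i => ?_⟩
    have h1 := hw ⟨LQT.refl (Δ i) * w, mul_mem (hsW i) w.2⟩
    simp only [LinearEquiv.mul_apply, LQT.refl_apply, inner_sub_left, real_inner_smul_left] at h1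
    have h2 : 0 ≤ 2 * ⟪(w : V ≃ₗ[ℝ] V) u, Δ i⟫ / ⟪Δ i, Δ i⟫ * ⟪Δ i, ∑ j, μ j⟫ := by linarith
    have h3 := nonneg_of_mul_nonneg_left h2 (hρ i)
    rw [le_div_iff₀ (hpos i)] at h3
    linarith
  -- lattice
  have hfin : ∀ R : ℝ, {v : V | v ∈ M ∧ ‖v‖ ≤ R}.Finite := LQT.lattice_fin hM
  have hprim := fun i => LQT.exists_prim M hfin (H.ne i) (hΔM i)
  choose d hd hdM hdn using hprim
  -- normalized coroots
  let p : Fin r → V → ℝ := fun i x => 2 * ⟪x, Δ i⟫ / ⟪Δ i, Δ i⟫ / d i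
  have hp : ∀ i x, LQT.refl (Δ i) x = x - p i x • (d i • Δ i) := by
    intro i x
    rw [LQT.refl_apply, smul_smul, div_mul_cancel₀ _ (hd i).ne']
  have hpadd : ∀ i x y, p i (x + y) = p i x + p i y := by
    intro i x y
    simp only [p, inner_add_left]; ring
  have hpint : ∀ i, ∀ x ∈ M, ∃ n : ℤ, p i x = n := by
    intro i x hx
    have h1 := M.sub_mem hx (hWM _ (hsW i) x hx)
    rw [LQT.refl_apply, sub_sub_cancel] at h1
    obtain ⟨n, hn⟩ := hdn i _ h1
    refine ⟨n, ?_⟩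
    simp only [p]
    rw [hn, mul_div_cancel_right₀ _ (hd i).ne']
  let lam : Fin r → V := fun i => (⟪Δ i, Δ i⟫ * d i / 2) • μ i
  have hplam : ∀ i j, p i (lam j) = if i = j then 1 else 0 := by
    intro i j
    simp only [p, lam, real_inner_smul_left, hμ]
    have h1 := (hpos i).ne'
    have h2 := (hd i).ne'
    by_cases h : i = j
    · subst h; simp only [if_true]; field_simp
    · simp [h, Ne.symm h]
  have hlamD : ∀ j, lam j ∈ fundDomain Δ := by
    intro j i
    simp only [lam, real_inner_smul_left, hμ]
    have h1 := hpos j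
    have h2 := hd j
    split_ifs <;> positivity
  have hlamM : ∀ w ∈ W, ∀ j, lam j - w (lam j) ∈ M := by
    intro w hw j
    obtain ⟨l, rfl⟩ := hword w hw
    clear hw
    induction l with
    | nil => simp [LQT.word]
    | cons i l ih =>
      have e : lam j - LQT.word Δ (i :: l) (lam j) =
          p i (lam j) • (d i • Δ i) + LQT.refl (Δ i) (lam j - LQT.word Δ l (lam j)) := by
        rw [LQT.word_cons, LinearEquiv.mul_apply, map_sub, hp i (lam j)]; abel
      rw [e]
      refine M.add_mem ?_ (hWM _ (hsW i) _ ih)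
      rw [hplam]
      split_ifs
      · rw [one_smul]; exact hdM i
      · rw [zero_smul]; exact M.zero_mem
  haveI : Fintype W := Fintype.ofFinite W
  have hX : ∀ j, LQT.Lead W M Δ (lam j) (orbitSum W (lam j)) := fun j =>
    LQT.Lead.orbit (hfund _ (hlamD j)) (fun w hw => hlamM w hw j)
  let N : AddSubmonoid V :=
    { carrier := fundDomain Δ ∩ (M : Set V)
      zero_mem' := ⟨fun i => by simp, M.zero_mem⟩
      add_mem' := fun {a b} ha hb => ⟨fun i => by
        rw [inner_add_left]; exact add_nonneg (ha.1 i) (hb.1 i), M.add_mem ha.2 hb.2⟩ }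
  let n : Fin r → V → ℕ := fun i x => ⌊p i x⌋₊
  have hn : ∀ i, ∀ x ∈ N, (n i x : ℝ) = p i x := by
    intro i x hx
    obtain ⟨k, hk⟩ := hpint i x hx.2
    have h0 : 0 ≤ p i x := div_nonneg (div_nonneg (mul_nonneg zero_le_two (hx.1 i))
      (hpos i).le) (hd i).le
    have hk0 : 0 ≤ k := by rw [hk] at h0; exact_mod_cast h0
    lift k to ℕ using hk0
    simp only [n]
    rw [hk]; simp
  have hnadd : ∀ i, ∀ x ∈ N, ∀ y ∈ N, n i (x + y) = n i x + n i y := by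
    intro i x hx y hy
    have h1 := hn i _ (N.add_mem hx hy)
    rw [hpadd, ← hn i x hx, ← hn i y hy] at h1
    exact_mod_cast h1
  have hn0 : ∀ i, n i 0 = 0 := by
    intro i; simp [n, p]
  let F : Multiplicative N →* AddMonoidAlgebra ℤ V :=
    { toFun := fun m => AddMonoidAlgebra.single
        ((m.toAdd : V) - ∑ i, n i (m.toAdd : V) • lam i) 1 *
          ∏ i, orbitSum W (lam i) ^ n i (m.toAdd : V)
      map_one' := by
        simp [hn0, AddMonoidAlgebra.one_def]
      map_mul' := by
        intro a b
        have hab := fun i => hnadd i _ a.toAdd.2 _ b.toAdd.2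
        simp only [toAdd_mul, AddSubmonoid.coe_add, hab, pow_add, Finset.prod_mul_distrib,
          add_smul, Finset.sum_add_distrib]
        rw [add_sub_add_comm, ← mul_one (1 : ℤ), ← AddMonoidAlgebra.single_mul_single]
        simp only [mul_one]
        ring }
  refine LQT.main_iso hl hin hdom hWM hfin N rfl F fun m => ?_
  have hfix : ∀ w ∈ W, w ((m : V) - ∑ i, n i (m : V) • lam i) = (m : V) - ∑ i, n i (m : V) • lam i := by
    intro w hw
    obtain ⟨l, rfl⟩ := hword w hw
    clear hw
    set x := (m : V) - ∑ i, n i (m : V) • lam i with hx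
    have hs : ∀ i, LQT.refl (Δ i) x = x := by
      intro i
      have hpx : p i x = 0 := by
        have e : p i (m : V) = p i x + ∑ j, n j (m : V) * p i (lam j) := by
          conv_lhs => rw [← sub_add_cancel (m : V) (∑ i, n i (m : V) • lam i), ← hx, hpadd]
          congr 1
          simp only [p, sum_inner, ← Nat.cast_smul_eq_nsmul ℝ, real_inner_smul_left,
            Finset.mul_sum, Finset.sum_div]
          refine Finset.sum_congr rfl fun j _ => ?_
          ring
        simp only [hplam] at e
        simp at e
        rw [hn i _ m.2] at e
        linarith
      rw [hp, hpx, zero_smul, sub_zero]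
    induction l with
    | nil => simp [LQT.word]
    | cons i l ih => rw [LQT.word_cons, LinearEquiv.mul_apply, ih, hs]
  have h1 := (LQT.Lead.single (M := M) (Δ := Δ) hfix).mul hl
    (LQT.Lead.prod hl Finset.univ fun i => (hX i).pow hl (n i (m : V)))
  rw [sub_add_cancel] at h1
  exact h1
end

section
/- Let W ⊂ GL(V) be a finite reflection group preserving a lattice M ⊂ V and a saturated affine semigroup S ⊂ M, and let D be the fundamental domain associated to a simple system Δ ⊂ M for W. Then there is an isomorphism of ℤ-algebras ℤ[D ∩ S] ≅ ℤ[S]^W. -/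
open scoped RealInnerProductSpace

/-- A saturated affine semigroup in the lattice `M`: a finitely generated additive
subsemigroup of `M` containing `0` such that `k • m ∈ S` for `k > 0`, `m ∈ M` implies `m ∈ S`. -/
def IsSaturatedAffineSemigroup {V : Type*} [NormedAddCommGroup V] [InnerProductSpace ℝ V]
    (M : Submodule ℤ V) (S : Set V) : Prop :=
  S ⊆ (M : Set V) ∧ (0 : V) ∈ S ∧ (∀ x ∈ S, ∀ y ∈ S, x + y ∈ S) ∧
  (∃ F : Finset V, (F : Set V) ⊆ S ∧ S ⊆ AddSubmonoid.closure (F : Set V)) ∧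
  (∀ k : ℕ, 0 < k → ∀ m ∈ M, k • m ∈ S → m ∈ S)


namespace SemiToric

section
variable {V : Type*} [NormedAddCommGroup V] [InnerProductSpace ℝ V]

/-- the pairing of `v` with the coroot of `a` -/
noncomputable def pr (a v : V) : ℝ := 2 * ⟪v, a⟫ / ⟪a, a⟫

lemma pr_add (a v w : V) : pr a (v + w) = pr a v + pr a w := by
  simp only [pr, inner_add_left]; ring

lemma pr_smul (a v : V) (c : ℝ) : pr a (c • v) = c * pr a v := by
  simp only [pr, real_inner_smul_left]; ring

lemma pr_sub (a v w : V) : pr a (v - w) = pr a v - pr a w := by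
  simp only [pr, inner_sub_left]; ring

lemma pr_sum {ι : Type*} (a : V) (s : Finset ι) (f : ι → V) :
    pr a (∑ i ∈ s, f i) = ∑ i ∈ s, pr a (f i) := by
  simp only [pr, sum_inner, Finset.mul_sum, Finset.sum_div]

lemma pr_self {a : V} (ha : a ≠ 0) : pr a a = 2 := by
  have : ⟪a, a⟫ ≠ 0 := by simpa using ha
  simp only [pr]; field_simp

/-- reflection -/
noncomputable def sref (a : V) : V ≃ₗ[ℝ] V :=
  LinearEquiv.ofInvolutive
    { toFun := fun v => v - pr a v • a
      map_add' := fun x y => by rw [pr_add]; module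
      map_smul' := fun c x => by rw [pr_smul]; simp only [RingHom.id_apply]; module }
    (fun v => by
      by_cases ha : a = 0
      · simp [ha]
      · simp only [LinearMap.coe_mk, AddHom.coe_mk]
        rw [pr_sub, pr_smul, pr_self ha]; module)

lemma sref_apply (a v : V) : sref a v = v - pr a v • a := rfl

lemma sref_sref (a v : V) : sref a (sref a v) = v := (sref a).left_inv v

lemma sref_mul_self (a : V) : sref a * sref a = 1 := by
  ext v; simp [sref_sref]

lemma inner_mul_pr (a v : V) : pr a v * ⟪a, a⟫ = 2 * ⟪v, a⟫ := by
  by_cases ha : a = 0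
  · simp [ha]
  · have : ⟪a, a⟫ ≠ 0 := by simpa using ha
    simp only [pr]; field_simp

lemma sref_inner (a x y : V) : ⟪sref a x, sref a y⟫ = ⟪x, y⟫ := by
  have h1 := inner_mul_pr a x
  simp only [sref_apply, inner_sub_left, inner_sub_right, real_inner_smul_left,
    real_inner_smul_right]
  have h3 : pr a x * ⟪y, a⟫ = pr a y * ⟪x, a⟫ := by unfold pr; ring
  have h2 : ⟪a, y⟫ = ⟪y, a⟫ := real_inner_comm _ _
  rw [h2]
  linear_combination (pr a y) * h1 - h3

lemma pr_scale (a v : V) {c : ℝ} (hc : c ≠ 0) : pr (c • a) v = c⁻¹ * pr a v := by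
  simp only [pr, real_inner_smul_left, real_inner_smul_right]; field_simp

lemma sref_scale (a : V) {c : ℝ} (hc : c ≠ 0) : sref (c • a) = sref a := by
  ext v; rw [sref_apply, sref_apply, pr_scale _ _ hc, smul_smul]; congr 2; field_simp

lemma sref_isRefl {a : V} (ha : a ≠ 0) : IsReflectionBy (sref a) a := ⟨ha, fun _ => rfl⟩

lemma isRefl_eq {g : V ≃ₗ[ℝ] V} {a : V} (h : IsReflectionBy g a) : g = sref a := by
  ext v; exact h.2 v

lemma pr_iso {w : V ≃ₗ[ℝ] V} (hw : ∀ x y, ⟪w x, w y⟫ = ⟪x, y⟫) (a v : V) :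
    pr (w a) (w v) = pr a v := by simp only [pr, hw]

lemma sref_conj {w : V ≃ₗ[ℝ] V} (hw : ∀ x y, ⟪w x, w y⟫ = ⟪x, y⟫) (a : V) :
    w * sref a = sref (w a) * w := by
  ext v
  simp only [LinearEquiv.mul_apply, sref_apply, pr_iso hw, map_sub, map_smul]

/-- nonnegative real combinations -/
def Pos {r : ℕ} (α : Fin r → V) (v : V) : Prop :=
  ∃ c : Fin r → ℝ, (∀ i, 0 ≤ c i) ∧ v = ∑ i, c i • α i

/-- product of simple reflections -/
noncomputable def wd {r : ℕ} (α : Fin r → V) (l : List (Fin r)) : V ≃ₗ[ℝ] V :=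
  (l.map fun i => sref (α i)).prod

lemma exists_dual [FiniteDimensional ℝ V] {r : ℕ} {α : Fin r → V}
    (h : LinearIndependent ℝ α) :
    ∃ μ : Fin r → V, ∀ k j, ⟪α j, μ k⟫ = if j = k then 1 else 0 := by
  classical
  let B := Module.Basis.sumExtend h
  refine ⟨fun k => (InnerProductSpace.toDual ℝ V).symm
    (LinearMap.toContinuousLinearMap (B.coord (Sum.inl k))), fun k j => ?_⟩
  rw [real_inner_comm, InnerProductSpace.toDual_symm_apply]
  have : α j = B (Sum.inl j) := by
    simp [B, Module.Basis.sumExtend]; rfl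
  simp only [LinearMap.coe_toContinuousLinearMap', this, Module.Basis.coord_apply,
    Module.Basis.repr_self, Finsupp.single_apply, Sum.inl.injEq]

section dual
variable {r : ℕ} {α μ : Fin r → V} (hμ : ∀ k j, ⟪α j, μ k⟫ = if j = k then 1 else 0)
include hμ

lemma inner_sum_dual (c : Fin r → ℝ) (k : Fin r) : ⟪∑ i, c i • α i, μ k⟫ = c k := by
  simp [sum_inner, real_inner_smul_left, hμ]

lemma ne_zero (i : Fin r) : α i ≠ 0 := by
  intro h; have := hμ i i; simp [h] at this

lemma Pos.inner_nonneg {v : V} (h : Pos α v) (k : Fin r) : 0 ≤ ⟪v, μ k⟫ := by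
  obtain ⟨c, hc, rfl⟩ := h
  rw [inner_sum_dual hμ]; exact hc k

lemma Pos.eq_sum {v : V} (h : Pos α v) : v = ∑ i, ⟪v, μ i⟫ • α i := by
  obtain ⟨c, hc, rfl⟩ := h
  simp only [inner_sum_dual hμ]

/-- a positive vector made negative by a simple reflection is a multiple of the simple root -/
lemma flip {v : V} {j : Fin r} (h : Pos α v) (h' : Pos α (-(sref (α j) v))) :
    ∃ c : ℝ, v = c • α j := by
  refine ⟨⟪v, μ j⟫, ?_⟩
  conv_lhs => rw [h.eq_sum hμ]
  refine Finset.sum_eq_single j (fun k _ hk => ?_) (by simp)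
  have h1 := h.inner_nonneg hμ k
  have h2 := h'.inner_nonneg hμ k
  rw [sref_apply, inner_neg_left, inner_sub_left, real_inner_smul_left, hμ k j,
    if_neg (Ne.symm hk)] at h2
  have : ⟪v, μ k⟫ = 0 := by linarith
  rw [this, zero_smul]

end dual

/-- The working context. -/
structure Ctx {r : ℕ} (W : Subgroup (V ≃ₗ[ℝ] V)) (α μ : Fin r → V) : Prop where
  hμ : ∀ k j, ⟪α j, μ k⟫ = if j = k then 1 else 0
  hs : ∀ i, sref (α i) ∈ W
  hiso : ∀ w ∈ W, ∀ x y, ⟪w x, w y⟫ = ⟪x, y⟫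
  hgen : ∀ w ∈ W, ∃ l : List (Fin r), w = wd α l
  hroot : ∀ w ∈ W, ∀ i, Pos α (w (α i)) ∨ Pos α (-(w (α i)))
  hint : ∀ i j, ∃ n : ℤ, pr (α j) (α i) = n

namespace Ctx
variable {r : ℕ} {W : Subgroup (V ≃ₗ[ℝ] V)} {α μ : Fin r → V} (C : Ctx W α μ)
include C

lemma wd_mem (l : List (Fin r)) : wd α l ∈ W := by
  apply Subgroup.list_prod_mem
  intro x hx
  obtain ⟨i, -, rfl⟩ := List.mem_map.1 hx
  exact C.hs i

lemma exchange (l : List (Fin r)) (i : Fin r) (h : Pos α (-(wd α l (α i)))) :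
    ∃ l' : List (Fin r), l'.length + 1 = l.length ∧ wd α l * sref (α i) = wd α l' := by
  induction l with
  | nil =>
    exfalso
    have := h.inner_nonneg C.hμ i
    simp [wd, C.hμ] at this
    linarith
  | cons j l ih =>
    have hc : wd α (j :: l) = sref (α j) * wd α l := by simp [wd]
    rcases C.hroot _ (C.wd_mem l) i with hp | hn
    · refine ⟨l, by simp, ?_⟩
      rw [hc, LinearEquiv.mul_apply] at h
      obtain ⟨c, hcc⟩ := flip C.hμ hp h
      have hc0 : c ≠ 0 := by
        rintro rfl
        rw [zero_smul] at hcc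
        exact ne_zero C.hμ i ((LinearEquiv.map_eq_zero_iff _).1 hcc)
      rw [hc, mul_assoc, sref_conj (C.hiso _ (C.wd_mem l)), hcc, sref_scale _ hc0, ← mul_assoc,
        sref_mul_self, one_mul]
    · obtain ⟨l', hl', he⟩ := ih hn
      refine ⟨j :: l', by simp [hl'], ?_⟩
      rw [hc, mul_assoc, he]; simp [wd]

lemma mem_intSpan (l : List (Fin r)) (i : Fin r) :
    wd α l (α i) ∈ Submodule.span ℤ (Set.range α) := by
  induction l with
  | nil => exact Submodule.subset_span ⟨i, by simp [wd]⟩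
  | cons j l ih =>
    have hc : wd α (j :: l) = sref (α j) * wd α l := by simp [wd]
    rw [hc, LinearEquiv.mul_apply]
    generalize wd α l (α i) = v at ih
    have : ∃ n : ℤ, pr (α j) v = n := by
      obtain ⟨c, rfl⟩ := (Submodule.mem_span_range_iff_exists_fun ℤ).1 ih
      choose n hn using fun i => C.hint i j
      refine ⟨∑ i, c i * n i, ?_⟩
      simp only [pr_sum, ← Int.cast_smul_eq_zsmul ℝ, pr_smul, hn]
      push_cast; rfl
    obtain ⟨n, hn⟩ := this
    rw [sref_apply, hn, Int.cast_smul_eq_zsmul]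
    exact Submodule.sub_mem _ ih (Submodule.smul_mem _ _ (Submodule.subset_span ⟨j, rfl⟩))

lemma mem_natSpan (l : List (Fin r)) (i : Fin r) (h : Pos α (wd α l (α i))) :
    wd α l (α i) ∈ Submodule.span ℕ (Set.range α) := by
  have h1 := C.mem_intSpan l i
  generalize wd α l (α i) = v at *
  obtain ⟨c, rfl⟩ := (Submodule.mem_span_range_iff_exists_fun ℤ).1 h1
  refine (Submodule.mem_span_range_iff_exists_fun ℕ).2 ⟨fun i => (c i).toNat, ?_⟩
  refine Finset.sum_congr rfl fun k _ => ?_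
  have := h.inner_nonneg C.hμ k
  simp only [← Int.cast_smul_eq_zsmul ℝ] at this
  rw [inner_sum_dual C.hμ (fun i => (c i : ℝ))] at this
  have h0 : 0 ≤ c k := by exact_mod_cast this
  conv_rhs => rw [← Int.toNat_of_nonneg h0, natCast_zsmul]

lemma dom_sub_aux {u : V} (hu : ∀ i, ∃ n : ℕ, pr (α i) u = n) (k : ℕ) :
    ∀ l : List (Fin r), l.length = k → u - wd α l u ∈ Submodule.span ℕ (Set.range α) := by
  induction k using Nat.strong_induction_on with
  | _ k ih =>
    intro l hl
    rcases List.eq_nil_or_concat l with rfl | ⟨l, i, rfl⟩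
    · simp [wd]
    · simp at hl
      have hc : wd α (l.concat i) = wd α l * sref (α i) := by simp [wd]
      rcases C.hroot _ (C.wd_mem l) i with hp | hn
      · rw [hc, LinearEquiv.mul_apply, sref_apply]
        obtain ⟨n, hn⟩ := hu i
        have : u - wd α l (u - pr (α i) u • α i) = (u - wd α l u) + n • wd α l (α i) := by
          rw [hn, map_sub, map_smul, Nat.cast_smul_eq_nsmul]; abel
        rw [this]
        exact add_mem (ih _ (by omega) l rfl) (Submodule.smul_mem _ _ (C.mem_natSpan l i hp))
      · obtain ⟨l', h', he⟩ := C.exchange l i hn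
        rw [hc, he]
        exact ih _ (by omega) l' rfl

lemma dom_sub {u : V} (hu : ∀ i, ∃ n : ℕ, pr (α i) u = n) {w : V ≃ₗ[ℝ] V} (hw : w ∈ W) :
    u - w u ∈ Submodule.span ℕ (Set.range α) := by
  obtain ⟨l, rfl⟩ := C.hgen w hw
  exact C.dom_sub_aux hu _ l rfl

/-- the height functional -/
lemma ht_alpha (i : Fin r) : ⟪α i, ∑ k, μ k⟫ = 1 := by
  simp [inner_sum, C.hμ]

lemma ht_nonneg {a : V} (ha : a ∈ Submodule.span ℕ (Set.range α)) :
    0 ≤ ⟪a, ∑ k, μ k⟫ ∧ (a ≠ 0 → 1 ≤ ⟪a, ∑ k, μ k⟫) := by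
  obtain ⟨c, rfl⟩ := (Submodule.mem_span_range_iff_exists_fun ℕ).1 ha
  have : ⟪∑ i, c i • α i, ∑ k, μ k⟫ = ((∑ i, c i : ℕ) : ℝ) := by
    simp only [← Nat.cast_smul_eq_nsmul ℝ, sum_inner, real_inner_smul_left, C.ht_alpha]
    push_cast; simp
  rw [this]
  refine ⟨Nat.cast_nonneg _, fun h => ?_⟩
  have : ∑ i, c i ≠ 0 := by
    intro h0
    apply h
    refine Finset.sum_eq_zero fun i _ => ?_
    rw [(Finset.sum_eq_zero_iff.1 h0) i (Finset.mem_univ _), zero_smul]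
  exact_mod_cast Nat.one_le_iff_ne_zero.2 this

lemma natSpan_pointed {a b : V} (ha : a ∈ Submodule.span ℕ (Set.range α))
    (hb : b ∈ Submodule.span ℕ (Set.range α)) (h : a + b = 0) : a = 0 := by
  by_contra h0
  have h1 := (C.ht_nonneg ha).2 h0
  have h2 := (C.ht_nonneg hb).1
  have : ⟪a + b, ∑ k, μ k⟫ = 0 := by rw [h, inner_zero_left]
  rw [inner_add_left] at this
  linarith

lemma norm_gap : ∃ δ : ℝ, 0 < δ ∧ ∀ u v : V, (∀ i, 0 ≤ ⟪v, α i⟫) → v ≠ u →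
    u - v ∈ Submodule.span ℕ (Set.range α) → ⟪v, v⟫ + δ ≤ ⟪u, u⟫ := by
  refine ⟨1 / (1 + ‖∑ k, μ k‖) ^ 2, by positivity, fun u v hv hne hA => ?_⟩
  have h1 := (C.ht_nonneg hA).2 (sub_ne_zero.2 hne.symm)
  have h2 := real_inner_le_norm (u - v) (∑ k, μ k)
  have h3 : 0 ≤ ⟪v, u - v⟫ := by
    obtain ⟨c, hc⟩ := (Submodule.mem_span_range_iff_exists_fun ℕ).1 hA
    rw [← hc, inner_sum]
    refine Finset.sum_nonneg fun i _ => ?_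
    rw [← Nat.cast_smul_eq_nsmul ℝ, real_inner_smul_right]
    exact mul_nonneg (Nat.cast_nonneg _) (hv i)
  have h4 : ⟪u, u⟫ = ⟪v, v⟫ + 2 * ⟪v, u - v⟫ + ‖u - v‖ ^ 2 := by
    rw [← real_inner_self_eq_norm_sq]
    simp only [inner_sub_left, inner_sub_right, real_inner_comm u v]; ring
  have h5 : 1 / (1 + ‖∑ k, μ k‖) ^ 2 ≤ ‖u - v‖ ^ 2 := by
    rw [div_le_iff₀ (by positivity), ← mul_pow]
    have : 1 ≤ ‖u - v‖ * (1 + ‖∑ k, μ k‖) := by nlinarith [norm_nonneg (u - v)]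
    nlinarith
  linarith

lemma exists_dom [Finite W] (v : V) : ∃ w ∈ W, ∀ i, 0 ≤ ⟪w v, α i⟫ := by
  obtain ⟨w, hw⟩ := Finite.exists_max (fun w : W => ⟪(w : V ≃ₗ[ℝ] V) v, ∑ k, μ k⟫)
  refine ⟨w, w.2, fun i => ?_⟩
  by_contra! h
  have h1 := hw (⟨sref (α i), C.hs i⟩ * w)
  simp only [Subgroup.coe_mul, LinearEquiv.mul_apply, sref_apply, inner_sub_left,
    real_inner_smul_left, C.ht_alpha] at h1
  have h2 : ⟪α i, α i⟫ > 0 := real_inner_self_pos.2 (ne_zero C.hμ i)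
  have : pr (α i) ((w : V ≃ₗ[ℝ] V) v) < 0 := by
    unfold pr; exact div_neg_of_neg_of_pos (by linarith) h2
  linarith

/-- weights below an element of a saturated set -/
lemma sat {M : Submodule ℤ V} {S : Set V} (hS : IsSaturatedAffineSemigroup M S)
    (hWS : ∀ w ∈ W, ∀ s ∈ S, (w : V ≃ₗ[ℝ] V) s ∈ S)
    (hαM : ∀ i, α i ∈ M) (hMint : ∀ m ∈ M, ∀ i, ∃ n : ℤ, pr (α i) m = n)
    {v : V} (hv : ∀ i, 0 ≤ ⟪v, α i⟫) (k : ℕ) :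
    ∀ c : Fin r → ℕ, ∑ i, c i = k → v + ∑ i, c i • α i ∈ S → v ∈ S := by
  classical
  induction k with
  | zero =>
    intro c hc h
    have h0 := Finset.sum_eq_zero_iff.1 hc
    rw [Finset.sum_eq_zero (fun i hi => by rw [h0 i hi, zero_smul]), add_zero] at h
    exact h
  | succ k ih =>
    intro c hc h
    set a := ∑ i, c i • α i with ha
    have haA : a ∈ Submodule.span ℕ (Set.range α) :=
      (Submodule.mem_span_range_iff_exists_fun ℕ).2 ⟨c, rfl⟩
    have ha0 : a ≠ 0 := by
      intro h0
      have : ∀ i, (c i : ℝ) = 0 := fun i => by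
        rw [← inner_sum_dual C.hμ (fun i => (c i : ℝ)) i]
        simp only [Nat.cast_smul_eq_nsmul, ← ha, h0, inner_zero_left]
      have : ∑ i, c i = 0 := Finset.sum_eq_zero fun i _ => by exact_mod_cast this i
      omega
    have hpos : 0 < ⟪a, a⟫ := real_inner_self_pos.2 ha0
    have hj : ∃ j, 0 < c j ∧ 0 < ⟪a, α j⟫ := by
      by_contra! hcon
      have : ⟪a, a⟫ ≤ 0 := by
        conv_lhs => rhs; rw [ha]
        rw [inner_sum]
        refine Finset.sum_nonpos fun i _ => ?_
        rw [← Nat.cast_smul_eq_nsmul ℝ, real_inner_smul_right]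
        rcases Nat.eq_zero_or_pos (c i) with h0 | h0
        · simp [h0]
        · exact mul_nonpos_of_nonneg_of_nonpos (Nat.cast_nonneg _) (hcon i h0)
      linarith
    obtain ⟨j, hcj, hj⟩ := hj
    obtain ⟨hSM, hS0, hSadd, -, hSsat⟩ := hS
    obtain ⟨n, hn⟩ := hMint _ (hSM h) j
    have h2 : ⟪α j, α j⟫ > 0 := real_inner_self_pos.2 (ne_zero C.hμ j)
    have hnpos : (0 : ℝ) < n := by
      rw [← hn, pr, inner_add_left]
      have := hv j
      positivity
    have hnpos' : 0 < n := by exact_mod_cast hnpos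
    obtain ⟨N, rfl⟩ : ∃ N : ℕ, n = N + 1 := ⟨(n - 1).toNat, by omega⟩
    have hmul : ∀ (N : ℕ) (x : V), x ∈ S → N • x ∈ S := by
      intro N x hx
      induction N with
      | zero => simpa using hS0
      | succ N ihN => rw [succ_nsmul]; exact hSadd _ ihN _ hx
    have hstep : v + a - α j ∈ S := by
      refine hSsat (N + 1) (by omega) _ (sub_mem (hSM h) (hαM j)) ?_
      have : (N + 1) • (v + a - α j) = N • (v + a) + sref (α j) (v + a) := by
        rw [sref_apply, hn]
        simp only [← Nat.cast_smul_eq_nsmul ℝ]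
        push_cast
        module
      rw [this]
      exact hSadd _ (hmul _ _ h) _ (hWS _ (C.hs j) _ h)
    have hc1 : c = Function.update c j (c j - 1) + Pi.single j 1 := by
      ext i
      by_cases hi : i = j
      · subst hi; simp; omega
      · simp [hi]
    apply ih (Function.update c j (c j - 1))
    · have : ∑ i, c i = ∑ i, (Function.update c j (c j - 1)) i + 1 := by
        conv_lhs => rw [hc1]
        simp [Finset.sum_add_distrib]
      omega
    · have : a = ∑ i, (Function.update c j (c j - 1)) i • α i + α j := by
        rw [ha]
        conv_lhs => rw [hc1]
        simp only [Pi.add_apply, add_smul, Finset.sum_add_distrib]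
        congr 1
        simp [Pi.single_apply]
      rw [this] at hstep
      rwa [← add_assoc, add_sub_cancel_right] at hstep

end Ctx
end

section
variable {V : Type*} [NormedAddCommGroup V] [InnerProductSpace ℝ V]

lemma lattice_functional {M : Submodule ℤ V} (hM : IsLattice M) {a : V} (ha : a ≠ 0) :
    ∃ f : V →ₗ[ℝ] ℝ, (∀ m ∈ M, ∃ n : ℤ, f m = n) ∧ f a ≠ 0 := by
  obtain ⟨b, hli, hsp, rfl⟩ := hM
  let B : Module.Basis b ℝ V := Module.Basis.mk hli (by simp [hsp])
  have hB : ∀ i, B i = i := fun i => by simp [B]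
  obtain ⟨j, hj⟩ : ∃ j, B.repr a j ≠ 0 := by
    by_contra! h
    apply ha
    apply B.repr.injective
    ext j; simpa using h j
  refine ⟨B.coord j, fun m hm => ?_, hj⟩
  induction hm using Submodule.span_induction with
  | mem x hx =>
    classical
    refine ⟨if (⟨x, hx⟩ : b) = j then 1 else 0, ?_⟩
    have : x = B ⟨x, hx⟩ := (hB ⟨x, hx⟩).symm
    conv_lhs => rw [this]
    simp only [Module.Basis.coord_apply, Module.Basis.repr_self, Finsupp.single_apply]
    split_ifs <;> simp
  | zero => exact ⟨0, by simp⟩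
  | add x y _ _ hx hy =>
    obtain ⟨n, hn⟩ := hx
    obtain ⟨m, hm⟩ := hy
    exact ⟨n + m, by rw [map_add, hn, hm]; push_cast; rfl⟩
  | smul c x _ hx =>
    obtain ⟨n, hn⟩ := hx
    exact ⟨c * n, by rw [map_zsmul, hn]; simp⟩

lemma exists_scale {M : Submodule ℤ V} (hM : IsLattice M) {a : V} (ha : a ≠ 0) (haM : a ∈ M)
    (hs : ∀ m ∈ M, sref a m ∈ M) :
    ∃ g : ℝ, 0 < g ∧ g • a ∈ M ∧ ∀ m ∈ M, ∃ n : ℤ, pr a m = n * g := by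
  obtain ⟨f, hf, hfa⟩ := lattice_functional hM ha
  have hpm : ∀ m ∈ M, pr a m • a ∈ M := fun m hm => by
    have : pr a m • a = m - sref a m := by rw [sref_apply]; abel
    rw [this]; exact sub_mem hm (hs m hm)
  let K : AddSubgroup ℤ :=
    { carrier := {z | ∃ m ∈ M, pr a m * f a = z}
      zero_mem' := ⟨0, M.zero_mem, by simp [pr]⟩
      add_mem' := by
        rintro x y ⟨m, hm, hx⟩ ⟨n, hn, hy⟩
        exact ⟨m + n, add_mem hm hn, by rw [pr_add]; push_cast; rw [← hx, ← hy]; ring⟩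
      neg_mem' := by
        rintro x ⟨m, hm, hx⟩
        exact ⟨-m, neg_mem hm, by push_cast; rw [← hx]; simp [pr]; ring⟩ }
  obtain ⟨d, hd⟩ := Int.subgroup_cyclic K
  have hdK : d ∈ K := by rw [hd]; exact AddSubgroup.subset_closure rfl
  obtain ⟨m0, hm0, hm0d⟩ := hdK
  have key : ∀ m ∈ M, ∃ n : ℤ, pr a m = n * pr a m0 := by
    intro m hm
    obtain ⟨z, hz⟩ := hf _ (hpm m hm)
    rw [map_smul, smul_eq_mul] at hz
    have hzK : z ∈ K := ⟨m, hm, hz⟩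
    rw [hd, AddSubgroup.mem_closure_singleton] at hzK
    obtain ⟨n, hn⟩ := hzK
    refine ⟨n, mul_right_cancel₀ hfa ?_⟩
    rw [hz, mul_assoc, hm0d, ← hn]; simp
  have h0 : pr a m0 ≠ 0 := by
    intro h
    obtain ⟨n, hn⟩ := key a haM
    rw [h, pr_self ha] at hn; simp at hn
  refine ⟨|pr a m0|, abs_pos.2 h0, ?_, fun m hm => ?_⟩
  · rcases abs_choice (pr a m0) with h | h <;> rw [h]
    · exact hpm m0 hm0
    · rw [neg_smul]; exact neg_mem (hpm m0 hm0)
  · obtain ⟨n, hn⟩ := key m hm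
    rcases abs_choice (pr a m0) with h | h <;> rw [h]
    · exact ⟨n, hn⟩
    · exact ⟨-n, by rw [hn]; push_cast; ring⟩

lemma exists_ctx [FiniteDimensional ℝ V] (W : Subgroup (V ≃ₗ[ℝ] V))
    (M : Submodule ℤ V) (hM : IsLattice M)
    (hWM : ∀ w ∈ W, ∀ m ∈ M, (w : V ≃ₗ[ℝ] V) m ∈ M)
    {r : ℕ} (Δ : Fin r → V) (hΔ : IsSimpleSystem W Δ) (hΔM : ∀ i, Δ i ∈ M) :
    ∃ (α μ : Fin r → V) (g : Fin r → ℝ), Ctx W α μ ∧ (∀ i, α i ∈ M) ∧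
      (∀ m ∈ M, ∀ i, ∃ n : ℤ, pr (α i) m = n) ∧ (∀ i, 0 < g i) ∧ (∀ i, α i = g i • Δ i) := by
  classical
  obtain ⟨hli, Φ, hΦ0, -, hΦr, hΦW, hΔΦ, hΦs⟩ := hΔ
  have hΔ0 : ∀ i, Δ i ≠ 0 := fun i h => hΦ0 (h ▸ hΔΦ i)
  have hrefW : ∀ β ∈ Φ, sref β ∈ W := fun β hβ => by
    rw [← hΦW]
    exact Subgroup.subset_closure ⟨β, hβ, sref_isRefl (fun h => hΦ0 (h ▸ hβ))⟩
  have hΦr' : ∀ α ∈ Φ, ∀ β ∈ Φ, sref α β ∈ Φ := hΦr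
  choose g hg0 hgM hgn using fun i => exists_scale hM (hΔ0 i) (hΔM i)
    (hWM _ (hrefW _ (hΔΦ i)))
  let α : Fin r → V := fun i => g i • Δ i
  have hα : ∀ i, α i = g i • Δ i := fun i => rfl
  have hsα : ∀ i, sref (α i) = sref (Δ i) := fun i => sref_scale _ (hg0 i).ne'
  have hliα : LinearIndependent ℝ α :=
    hli.units_smul (fun i => Units.mk0 (g i) (hg0 i).ne')
  obtain ⟨μ, hμ⟩ := exists_dual hliα
  have hMint : ∀ m ∈ M, ∀ i, ∃ n : ℤ, pr (α i) m = n := fun m hm i => by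
    obtain ⟨n, hn⟩ := hgn i m hm
    refine ⟨n, ?_⟩
    rw [hα, pr_scale _ _ (hg0 i).ne', hn]
    have := (hg0 i).ne'
    field_simp
  have hPosN : ∀ β ∈ Φ, Pos α β ∨ Pos α (-β) := by
    intro β hβ
    rcases hΦs β hβ with ⟨c, hc, h⟩ | ⟨c, hc, h⟩
    · left
      refine ⟨fun i => c i / g i, fun i => div_nonneg (hc i) (hg0 i).le, ?_⟩
      rw [h]
      refine Finset.sum_congr rfl fun i _ => ?_
      rw [hα, smul_smul, div_mul_cancel₀ _ (hg0 i).ne']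
    · right
      refine ⟨fun i => -c i / g i, fun i => div_nonneg (by linarith [hc i]) (hg0 i).le, ?_⟩
      rw [h, ← Finset.sum_neg_distrib]
      refine Finset.sum_congr rfl fun i _ => ?_
      rw [hα, smul_smul, div_mul_cancel₀ _ (hg0 i).ne', neg_smul]
  have hiso : ∀ w ∈ W, ∀ x y, ⟪w x, w y⟫ = ⟪x, y⟫ := by
    intro w hw
    rw [← hΦW] at hw
    induction hw using Subgroup.closure_induction with
    | mem w hw =>
      obtain ⟨β, hβ, h⟩ := hw
      rw [isRefl_eq h]; exact sref_inner β
    | one => intro x y; rfl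
    | mul a b _ _ ha hb => intro x y; simp only [LinearEquiv.mul_apply, ha, hb]
    | inv a _ ha =>
      intro x y
      rw [← ha]
      simp only [← LinearEquiv.mul_apply, mul_inv_cancel, LinearEquiv.coe_one, id]
  have hΦst : ∀ w ∈ W, ∀ β, β ∈ Φ ↔ w β ∈ Φ := by
    intro w hw
    rw [← hΦW] at hw
    induction hw using Subgroup.closure_induction with
    | mem w hw =>
      obtain ⟨γ, hγ, h⟩ := hw
      rw [isRefl_eq h]
      intro β
      refine ⟨hΦr' γ hγ β, fun h => ?_⟩
      have := hΦr' γ hγ _ h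
      rwa [sref_sref] at this
    | one => intro x; rfl
    | mul a b _ _ ha hb => intro x; rw [hb, ha, LinearEquiv.mul_apply]
    | inv a _ ha =>
      intro x
      rw [ha (a⁻¹ x)]
      simp only [← LinearEquiv.mul_apply, mul_inv_cancel, LinearEquiv.coe_one, id]
  have hsW : ∀ i, sref (α i) ∈ W := fun i => by rw [hsα]; exact hrefW _ (hΔΦ i)
  let G : Subgroup (V ≃ₗ[ℝ] V) := Subgroup.closure (Set.range fun i => sref (α i))
  have hsG : ∀ i, sref (α i) ∈ G := fun i => Subgroup.subset_closure ⟨i, rfl⟩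
  have hGW : G ≤ W := by
    rw [Subgroup.closure_le]; rintro _ ⟨i, rfl⟩; exact hsW i
  have hpos : ∀ β ∈ Φ, Pos α β → sref β ∈ G := by
    intro β hβ hpβ
    let T := Φ.filter fun γ => Pos α γ ∧ ∃ w ∈ G, w β = γ
    have hT : T.Nonempty := ⟨β, Finset.mem_filter.2 ⟨hβ, hpβ, 1, G.one_mem, rfl⟩⟩
    obtain ⟨γ, hγT, hmin⟩ := Finset.exists_min_image T (fun v => ⟪v, ∑ k, μ k⟫) hT
    obtain ⟨hγΦ, hγp, w, hwG, hwγ⟩ := Finset.mem_filter.1 hγT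
    have hγ0 : γ ≠ 0 := fun h => hΦ0 (h ▸ hγΦ)
    have hex : ∃ i, 0 < ⟪γ, α i⟫ := by
      by_contra! hcon
      have h1 : 0 < ⟪γ, γ⟫ := real_inner_self_pos.2 hγ0
      have : ⟪γ, γ⟫ ≤ 0 := by
        obtain ⟨c, hc, hγ⟩ := hγp
        conv_lhs => rhs; rw [hγ]
        rw [inner_sum]
        refine Finset.sum_nonpos fun i _ => ?_
        rw [real_inner_smul_right]
        exact mul_nonpos_of_nonneg_of_nonpos (hc i) (hcon i)
      linarith
    obtain ⟨i, hi⟩ := hex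
    have hsΦ : sref (α i) γ ∈ Φ := by rw [hsα]; exact hΦr' _ (hΔΦ i) _ hγΦ
    have hconj : w * sref β = sref γ * w := by
      rw [sref_conj (hiso w (hGW hwG)), hwγ]
    have hfin : sref γ ∈ G → sref β ∈ G := by
      intro h
      have : sref β = w⁻¹ * (sref γ * w) := by rw [← hconj, inv_mul_cancel_left]
      rw [this]
      exact G.mul_mem (G.inv_mem hwG) (G.mul_mem h hwG)
    apply hfin
    rcases hPosN _ hsΦ with hp | hn
    · exfalso
      have := hmin (sref (α i) γ) (Finset.mem_filter.2 ⟨hsΦ, hp, sref (α i) * w,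
        G.mul_mem (hsG i) hwG, by rw [LinearEquiv.mul_apply, hwγ]⟩)
      have h1 : ⟪α i, ∑ k, μ k⟫ = 1 := by simp [inner_sum, hμ]
      simp only [sref_apply, inner_sub_left, real_inner_smul_left, h1] at this
      have h2 : ⟪α i, α i⟫ > 0 := real_inner_self_pos.2 (ne_zero hμ i)
      have : 0 < pr (α i) γ := by unfold pr; positivity
      linarith
    · obtain ⟨c, hc⟩ := flip hμ hγp hn
      have hc0 : c ≠ 0 := by rintro rfl; simp at hc; exact hγ0 hc
      rw [hc, sref_scale _ hc0]; exact hsG i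
  have hall : ∀ β ∈ Φ, sref β ∈ G := by
    intro β hβ
    rcases hPosN β hβ with h | h
    · exact hpos β hβ h
    · have h1 : sref β β = -β := by
        rw [sref_apply, pr_self (fun h => hΦ0 (h ▸ hβ))]; module
      have h2 := hpos (-β) (h1 ▸ hΦr' β hβ β hβ) h
      have h3 : sref (-β) = sref β := by
        rw [← sref_scale β (c := -1) (by norm_num)]; simp
      rwa [h3] at h2
  have hWG : W ≤ G := by
    rw [← hΦW, Subgroup.closure_le]
    rintro w ⟨β, hβ, h⟩
    rw [isRefl_eq h]; exact hall β hβ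
  refine ⟨α, μ, g, ⟨hμ, hsW, hiso, ?_, ?_, fun i j => hMint _ (hgM i) j⟩, hgM, hMint, hg0, hα⟩
  · intro w hw
    replace hw := hWG hw
    induction hw using Subgroup.closure_induction with
    | mem w hw => obtain ⟨i, rfl⟩ := hw; exact ⟨[i], by simp [wd]⟩
    | one => exact ⟨[], by simp [wd]⟩
    | mul a b _ _ ha hb =>
      obtain ⟨l, rfl⟩ := ha
      obtain ⟨l', rfl⟩ := hb
      exact ⟨l ++ l', by simp [wd]⟩
    | inv a _ ha =>
      obtain ⟨l, rfl⟩ := ha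
      refine ⟨l.reverse, ?_⟩
      have hinv : ∀ a : V, (sref a)⁻¹ = sref a := fun a =>
        inv_eq_of_mul_eq_one_left (sref_mul_self a)
      simp only [wd, List.prod_inv_reverse, List.map_map, List.map_reverse]
      simp [Function.comp_def, hinv]
  · intro w hw i
    have : w (α i) = g i • w (Δ i) := by rw [hα, map_smul]
    have h := hPosN _ ((hΦst w hw _).1 (hΔΦ i))
    rw [this]
    rcases h with ⟨c, hc, h⟩ | ⟨c, hc, h⟩
    · left
      refine ⟨fun k => g i * c k, fun k => mul_nonneg (hg0 i).le (hc k), ?_⟩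
      rw [h, Finset.smul_sum]; simp only [smul_smul]
    · right
      refine ⟨fun k => g i * c k, fun k => mul_nonneg (hg0 i).le (hc k), ?_⟩
      rw [← smul_neg, h, Finset.smul_sum]; simp only [smul_smul]

end

section
variable {V : Type*} [NormedAddCommGroup V] [InnerProductSpace ℝ V]

lemma mem_semigroupAlg {G : Type*} [AddCommMonoid G] (T : AddSubmonoid G)
    (f : AddMonoidAlgebra ℤ G) :
    f ∈ semigroupAlg (T : Set G) ↔ ∀ v, f.coeff v ≠ 0 → v ∈ T := by
  classical
  constructor
  · intro hf
    refine Algebra.adjoin_induction (p := fun f _ => ∀ v, f.coeff v ≠ 0 → v ∈ T) ?_ ?_ ?_ ?_ hf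
    · rintro _ ⟨s, hs, rfl⟩ v hv
      rw [AddMonoidAlgebra.coeff_single, Finsupp.single_apply] at hv
      by_cases h : s = v
      · exact h ▸ hs
      · simp [h] at hv
    · intro c v hv
      rw [AddMonoidAlgebra.coe_algebraMap, Function.comp_apply, AddMonoidAlgebra.coeff_single,
        Finsupp.single_apply] at hv
      by_cases h : 0 = v
      · exact h ▸ T.zero_mem
      · simp [h] at hv
    · intro x y _ _ hx hy v hv
      rw [AddMonoidAlgebra.coeff_add, Finsupp.add_apply] at hv
      by_cases h : x.coeff v = 0
      · exact hy v (by simpa [h] using hv)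
      · exact hx v h
    · intro x y _ _ hx hy v hv
      have := AddMonoidAlgebra.support_coeff_mul_subset x y (Finsupp.mem_support_iff.2 hv)
      obtain ⟨a, ha, b, hb, rfl⟩ := Finset.mem_add.1 this
      exact T.add_mem (hx a (Finsupp.mem_support_iff.1 ha)) (hy b (Finsupp.mem_support_iff.1 hb))
  · intro h
    have hf : f = ∑ v ∈ f.coeff.support, f.coeff v • AddMonoidAlgebra.single v (1 : ℤ) := by
      apply AddMonoidAlgebra.coeff_injective
      ext x
      simp [AddMonoidAlgebra.coeff_sum, Finsupp.finsetSum_apply, Finsupp.single_apply]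
    rw [hf]
    refine Subalgebra.sum_mem _ fun v hv => Subalgebra.smul_mem _ ?_ _
    exact Algebra.subset_adjoin ⟨v, h v (Finsupp.mem_support_iff.1 hv), rfl⟩

lemma range_incl {G : Type*} [AddCommMonoid G] (T : AddSubmonoid G) :
    (AddMonoidAlgebra.mapDomainAlgHom ℤ ℤ T.subtype).range = semigroupAlg (T : Set G) := by
  classical
  apply le_antisymm
  · rintro _ ⟨y, rfl⟩
    induction y using AddMonoidAlgebra.induction_linear with
    | zero => simp
    | add f g hf hg => rw [map_add]; exact add_mem hf hg
    | single a b =>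
      rw [mem_semigroupAlg]
      intro v hv
      simp [Finsupp.single_apply] at hv
      rw [← hv.1]; exact a.2
  · refine Algebra.adjoin_le ?_
    rintro _ ⟨s, hs, rfl⟩
    exact ⟨AddMonoidAlgebra.single ⟨s, hs⟩ 1, by simp⟩

lemma coeff_algAut (w : V ≃ₗ[ℝ] V) (f : AddMonoidAlgebra ℤ V) (v : V) :
    (algAut w f).coeff v = f.coeff (w.symm v) := by
  unfold algAut
  rw [AddMonoidAlgebra.coeff_domCongr]; rfl

lemma mem_fixed {W : Subgroup (V ≃ₗ[ℝ] V)} {f : AddMonoidAlgebra ℤ V}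
    (hf : f ∈ fixedSubalgebra W) {w : V ≃ₗ[ℝ] V} (hw : w ∈ W) (v : V) :
    f.coeff (w v) = f.coeff v := by
  have := hf w hw
  conv_lhs => rw [← this]
  rw [coeff_algAut, LinearEquiv.symm_apply_apply]

lemma coeff_orbitSum (W : Subgroup (V ≃ₗ[ℝ] V)) [Fintype W] (u v : V)
    [Decidable (∃ w ∈ W, w u = v)] :
    (orbitSum W u).coeff v = if ∃ w ∈ W, w u = v then 1 else 0 := by
  classical
  simp [orbitSum, AddMonoidAlgebra.coeff_sum, Finsupp.finsetSum_apply, Finsupp.single_apply]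

lemma orbitSum_fixed (W : Subgroup (V ≃ₗ[ℝ] V)) [Fintype W] (u : V) :
    orbitSum W u ∈ fixedSubalgebra W := by
  classical
  intro w hw
  apply AddMonoidAlgebra.coeff_injective
  ext v
  rw [coeff_algAut, coeff_orbitSum, coeff_orbitSum]
  congr 1
  apply propext
  constructor
  · rintro ⟨g, hg, h⟩
    exact ⟨w * g, W.mul_mem hw hg, by rw [LinearEquiv.mul_apply, h, LinearEquiv.apply_symm_apply]⟩
  · rintro ⟨g, hg, h⟩
    refine ⟨w⁻¹ * g, W.mul_mem (W.inv_mem hw) hg, ?_⟩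
    rw [LinearEquiv.mul_apply, h]; rfl

/-- leading term condition -/
def Lead {r : ℕ} (α : Fin r → V) (f : AddMonoidAlgebra ℤ V) (u : V) : Prop :=
  f.coeff u = 1 ∧ ∀ v, f.coeff v ≠ 0 → u - v ∈ Submodule.span ℕ (Set.range α)

lemma lead_single {r : ℕ} (α : Fin r → V) (u : V) :
    Lead α (AddMonoidAlgebra.single u 1) u := by
  classical
  refine ⟨by simp, fun v hv => ?_⟩
  rw [AddMonoidAlgebra.coeff_single, Finsupp.single_apply] at hv
  have : u = v := by by_contra h; simp [h] at hv
  rw [this, sub_self]; exact zero_mem _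

/-- fundamental weights -/
noncomputable def fw {r : ℕ} (α μ : Fin r → V) (i : Fin r) : V := (⟪α i, α i⟫ / 2) • μ i

/-- the exponents -/
noncomputable def ex {r : ℕ} (α : Fin r → V) (u : V) (i : Fin r) : ℕ := ⌊pr (α i) u⌋₊

/-- images of the characters -/
noncomputable def phi {r : ℕ} (W : Subgroup (V ≃ₗ[ℝ] V)) [Fintype W] (α μ : Fin r → V) (u : V) :
    AddMonoidAlgebra ℤ V :=
  (∏ i, orbitSum W (fw α μ i) ^ ex α u i) *
    AddMonoidAlgebra.single (u - ∑ i, ex α u i • fw α μ i) 1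

/-- dominant integral -/
def DI {r : ℕ} (α : Fin r → V) (u : V) : Prop := ∀ i, ∃ n : ℕ, pr (α i) u = n

lemma ex_eq {r : ℕ} {α : Fin r → V} {u : V} (hu : DI α u) (i : Fin r) :
    pr (α i) u = ex α u i := by
  obtain ⟨n, hn⟩ := hu i
  rw [ex, hn, Nat.floor_natCast]

lemma ex_add {r : ℕ} {α : Fin r → V} {u v : V} (hu : DI α u) (hv : DI α v) (i : Fin r) :
    ex α (u + v) i = ex α u i + ex α v i := by
  have h : pr (α i) (u + v) = ((ex α u i + ex α v i : ℕ) : ℝ) := by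
    rw [pr_add, ex_eq hu, ex_eq hv]; push_cast; rfl
  conv_lhs => rw [ex, h, Nat.floor_natCast]

lemma ex_zero {r : ℕ} {α : Fin r → V} (i : Fin r) : ex α 0 i = 0 := by
  simp [ex, pr]

section phi
variable {r : ℕ} {W : Subgroup (V ≃ₗ[ℝ] V)} {α μ : Fin r → V} [Fintype W]

lemma phi_zero : phi W α μ 0 = 1 := by
  simp [phi, ex_zero, AddMonoidAlgebra.one_def]

lemma phi_add {u v : V} (hu : DI α u) (hv : DI α v) :
    phi W α μ (u + v) = phi W α μ u * phi W α μ v := by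
  simp only [phi, ex_add hu hv, pow_add, Finset.prod_mul_distrib, add_smul,
    Finset.sum_add_distrib]
  rw [mul_mul_mul_comm, AddMonoidAlgebra.single_mul_single, mul_one]
  congr 2
  abel

namespace Ctx
variable (C : Ctx W α μ)
include C

lemma Lead.mul {f g : AddMonoidAlgebra ℤ V} {u v : V} (hf : Lead α f u) (hg : Lead α g v) :
    Lead α (f * g) (u + v) := by
  classical
  constructor
  · rw [AddMonoidAlgebra.coeff_mul_add_of_uniqueAdd, hf.1, hg.1, mul_one]
    intro a b ha hb hab
    have ha := hf.2 a (Finsupp.mem_support_iff.1 ha)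
    have hb := hg.2 b (Finsupp.mem_support_iff.1 hb)
    have h1 : (u - a) + (v - b) = 0 := by rw [← sub_self (u + v)]; nth_rw 2 [← hab]; abel
    have h2 := C.natSpan_pointed ha hb h1
    have h3 := C.natSpan_pointed hb ha (by rw [add_comm]; exact h1)
    exact ⟨(sub_eq_zero.1 h2).symm, (sub_eq_zero.1 h3).symm⟩
  · intro x hx
    have := AddMonoidAlgebra.support_coeff_mul_subset f g (Finsupp.mem_support_iff.2 hx)
    obtain ⟨a, ha, b, hb, rfl⟩ := Finset.mem_add.1 this
    have ha := hf.2 a (Finsupp.mem_support_iff.1 ha)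
    have hb := hg.2 b (Finsupp.mem_support_iff.1 hb)
    rw [add_sub_add_comm]
    exact add_mem ha hb

lemma Lead.pow {f : AddMonoidAlgebra ℤ V} {u : V} (hf : Lead α f u) (n : ℕ) :
    Lead α (f ^ n) (n • u) := by
  induction n with
  | zero => simpa [AddMonoidAlgebra.one_def] using lead_single α 0
  | succ n ih => rw [pow_succ, succ_nsmul]; exact Lead.mul C ih hf

lemma Lead.prod {f : Fin r → AddMonoidAlgebra ℤ V} {u : Fin r → V} (hf : ∀ i, Lead α (f i) (u i))
    (s : Finset (Fin r)) : Lead α (∏ i ∈ s, f i) (∑ i ∈ s, u i) := by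
  classical
  induction s using Finset.induction_on with
  | empty => simpa [AddMonoidAlgebra.one_def] using lead_single α 0
  | insert a s ha ih =>
    rw [Finset.prod_insert ha, Finset.sum_insert ha]; exact Lead.mul C (hf a) ih

lemma pr_fw (i j : Fin r) : pr (α j) (fw α μ i) = if j = i then 1 else 0 := by
  rw [fw, pr_smul, pr, real_inner_comm (α j) (μ i), C.hμ]
  have : ⟪α j, α j⟫ ≠ 0 := (real_inner_self_pos.2 (ne_zero C.hμ j)).ne'
  split_ifs with h
  · subst h; field_simp
  · simp

lemma lead_orbit {u : V} (hu : DI α u) : Lead α (orbitSum W u) u := by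
  classical
  refine ⟨?_, fun v hv => ?_⟩
  · rw [coeff_orbitSum, if_pos ⟨1, W.one_mem, rfl⟩]
  · rw [coeff_orbitSum] at hv
    have : ∃ w ∈ W, w u = v := by by_contra h; simp [h] at hv
    obtain ⟨w, hw, rfl⟩ := this
    exact C.dom_sub hu hw

lemma lead_phi (u : V) : Lead α (phi W α μ u) u := by
  have h1 : ∀ i, Lead α (orbitSum W (fw α μ i)) (fw α μ i) := fun i =>
    C.lead_orbit fun j => ⟨if j = i then 1 else 0, by rw [C.pr_fw]; push_cast; rfl⟩
  have := Lead.mul C (Lead.prod C (fun i => Lead.pow C (h1 i) (ex α u i)) Finset.univ)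
    (lead_single α (u - ∑ i, ex α u i • fw α μ i))
  rwa [add_sub_cancel] at this

lemma fix_of_orth {v : V} (hv : ∀ i, pr (α i) v = 0) {w : V ≃ₗ[ℝ] V} (hw : w ∈ W) : w v = v := by
  obtain ⟨l, rfl⟩ := C.hgen w hw
  clear hw
  induction l with
  | nil => simp [wd]
  | cons i l ih =>
    have hc : wd α (i :: l) = sref (α i) * wd α l := by simp [wd]
    rw [hc, LinearEquiv.mul_apply, ih, sref_apply, hv i, zero_smul, sub_zero]

lemma phi_fixed {u : V} (hu : DI α u) : phi W α μ u ∈ fixedSubalgebra W := by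
  refine mul_mem (prod_mem fun i _ => pow_mem (orbitSum_fixed W _) _) ?_
  intro w hw
  have : w (u - ∑ i, ex α u i • fw α μ i) = u - ∑ i, ex α u i • fw α μ i := by
    refine C.fix_of_orth (fun j => ?_) hw
    rw [pr_sub, pr_sum, ex_eq hu]
    simp only [← Nat.cast_smul_eq_nsmul ℝ, pr_smul, C.pr_fw]
    simp
  unfold algAut
  rw [AddMonoidAlgebra.domCongr_single]
  congr 1

end Ctx
end phi
end

end SemiToric

open SemiToric in
theorem saturated_semigroup_quotient_toric
    {V : Type*} [NormedAddCommGroup V] [InnerProductSpace ℝ V] [FiniteDimensional ℝ V]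
    (W : Subgroup (V ≃ₗ[ℝ] V)) [Finite W] (hW : IsReflectionGroup W)
    (M : Submodule ℤ V) (hM : IsLattice M)
    (hWM : ∀ w ∈ W, ∀ m ∈ M, (w : V ≃ₗ[ℝ] V) m ∈ M)
    (S : Set V) (hS : IsSaturatedAffineSemigroup M S)
    (hWS : ∀ w ∈ W, ∀ s ∈ S, (w : V ≃ₗ[ℝ] V) s ∈ S)
    {r : ℕ} (Δ : Fin r → V) (hΔ : IsSimpleSystem W Δ) (hΔM : ∀ i, Δ i ∈ M) :
    Nonempty ((semigroupAlg (fundDomain Δ ∩ S)) ≃ₐ[ℤ]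
      ↥(semigroupAlg S ⊓ fixedSubalgebra W)) := by
  classical
  haveI : Fintype W := Fintype.ofFinite W
  obtain ⟨α, μ, g, C, hαM, hMint, hg0, hα⟩ := exists_ctx W M hM hWM Δ hΔ hΔM
  have hS' := hS
  obtain ⟨hSM, hS0, hSadd, -, -⟩ := hS'
  let S' : AddSubmonoid V :=
    { carrier := S, zero_mem' := hS0, add_mem' := fun {a b} ha hb => hSadd a ha b hb }
  let T : AddSubmonoid V :=
    { carrier := fundDomain Δ ∩ S
      zero_mem' := ⟨fun i => by simp, hS0⟩
      add_mem' := fun {a b} ha hb => ⟨fun i => by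
        rw [inner_add_left]; exact add_nonneg (ha.1 i) (hb.1 i), hSadd a ha.2 b hb.2⟩ }
  have hTe : (T : Set V) = fundDomain Δ ∩ S := rfl
  have hS'e : (S' : Set V) = S := rfl
  have hdom : ∀ v, v ∈ fundDomain Δ ↔ ∀ i, 0 ≤ ⟪v, α i⟫ := by
    intro v
    refine forall_congr' fun i => ?_
    rw [hα, real_inner_smul_right, mul_nonneg_iff_of_pos_left (hg0 i)]
  have hDI : ∀ u ∈ T, DI α u := by
    intro u hu i
    obtain ⟨n, hn⟩ := hMint u (hSM hu.2) i
    have h0 : (0 : ℝ) ≤ n := by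
      rw [← hn, pr]
      have := (hdom u).1 hu.1 i
      have h2 : 0 ≤ ⟪α i, α i⟫ := real_inner_self_nonneg
      positivity
    have h0' : 0 ≤ n := by exact_mod_cast h0
    obtain ⟨k, rfl⟩ := Int.eq_ofNat_of_zero_le h0'
    exact ⟨k, by rw [hn]; simp⟩
  have hphiS : ∀ u ∈ T, phi W α μ u ∈ semigroupAlg S := by
    intro u hu
    rw [← hS'e, mem_semigroupAlg]
    intro v hv
    obtain ⟨w, hw, hwd⟩ := C.exists_dom v
    have hfix := C.phi_fixed (hDI u hu)
    have hv' : (phi W α μ u).coeff (w v) ≠ 0 := by rwa [mem_fixed hfix hw]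
    have hA := (C.lead_phi u).2 _ hv'
    obtain ⟨c, hc⟩ := (Submodule.mem_span_range_iff_exists_fun ℕ).1 hA
    have hwv : w v ∈ S := by
      refine C.sat hS hWS hαM hMint hwd _ c rfl ?_
      rw [hc, add_sub_cancel]; exact hu.2
    have := hWS w⁻¹ (W.inv_mem hw) _ hwv
    rw [← LinearEquiv.mul_apply, inv_mul_cancel] at this
    exact this
  let F : Multiplicative T →* AddMonoidAlgebra ℤ V :=
    { toFun := fun u => phi W α μ (u.toAdd : V)
      map_one' := phi_zero
      map_mul' := fun u v => phi_add (hDI _ u.toAdd.2) (hDI _ v.toAdd.2) }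
  let L : AddMonoidAlgebra ℤ T →ₐ[ℤ] AddMonoidAlgebra ℤ V := AddMonoidAlgebra.lift ℤ _ T F
  have hLs : ∀ (u : T) (c : ℤ), L (AddMonoidAlgebra.single u c) = c • phi W α μ u := by
    intro u c; simp only [L, AddMonoidAlgebra.lift_single]; rfl
  have hLc : ∀ (f : AddMonoidAlgebra ℤ T) (v : V),
      (L f).coeff v = ∑ u ∈ f.coeff.support, f.coeff u * (phi W α μ u).coeff v := by
    intro f v
    simp only [L, AddMonoidAlgebra.lift_apply, Finsupp.sum, AddMonoidAlgebra.coeff_sum,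
      Finsupp.finsetSum_apply, AddMonoidAlgebra.coeff_smul, Finsupp.smul_apply, smul_eq_mul]
    rfl
  obtain ⟨δ, hδ, hgap⟩ := C.norm_gap
  have hinj : Function.Injective L := by
    rw [injective_iff_map_eq_zero]
    intro f hf
    by_contra hne
    have hsupp : f.coeff.support.Nonempty := by
      rw [Finsupp.support_nonempty_iff]; simpa using hne
    obtain ⟨u, hu, hmax⟩ := Finset.exists_max_image f.coeff.support
      (fun u : T => ⟪(u : V), (u : V)⟫) hsupp
    have h0 := hLc f u
    rw [hf, Finset.sum_eq_single u, (C.lead_phi u).1] at h0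
    · simp at h0
      exact Finsupp.mem_support_iff.1 hu h0.symm
    · intro b hb hbu
      by_contra h
      have h1 : (phi W α μ b).coeff u ≠ 0 := fun h1 => h (by rw [h1, mul_zero])
      have h2 := hgap b u ((hdom _).1 u.2.1) (fun h => hbu (Subtype.ext h.symm))
        ((C.lead_phi b).2 _ h1)
      have := hmax b hb
      linarith
    · intro h; exact absurd hu h
  have hsurj : ∀ n : ℕ, ∀ f ∈ semigroupAlg S ⊓ fixedSubalgebra W,
      (∀ v, f.coeff v ≠ 0 → (∀ i, 0 ≤ ⟪v, α i⟫) → ⟪v, v⟫ < n * δ) → f ∈ L.range := by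
    intro n
    induction n with
    | zero =>
      intro f hf hv
      have : f = 0 := by
        apply AddMonoidAlgebra.coeff_injective
        ext v
        by_contra h
        obtain ⟨w, hw, hwd⟩ := C.exists_dom v
        have h1 : f.coeff (w v) ≠ 0 := by rw [mem_fixed hf.2 hw]; exact h
        have h2 := hv _ h1 hwd
        have h3 : 0 ≤ ⟪w v, w v⟫ := real_inner_self_nonneg
        rw [Nat.cast_zero, zero_mul] at h2
        linarith
      rw [this]; exact zero_mem _
    | succ n ih =>
      intro f hf hv
      have hfS : f ∈ semigroupAlg S := hf.1
      rw [← hS'e, mem_semigroupAlg] at hfS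
      let P := f.coeff.support.filter fun v => ∀ i, 0 ≤ ⟪v, α i⟫
      have hPT : ∀ v ∈ P, v ∈ T := fun v hv' => by
        obtain ⟨h1, h2⟩ := Finset.mem_filter.1 hv'
        exact ⟨(hdom v).2 h2, hfS v (Finsupp.mem_support_iff.1 h1)⟩
      have hq : ∑ v ∈ P, f.coeff v • phi W α μ v ∈ L.range := by
        refine sum_mem fun v hv' => ?_
        exact ⟨AddMonoidAlgebra.single ⟨v, hPT v hv'⟩ (f.coeff v), hLs ⟨v, hPT v hv'⟩ _⟩
      have hq' : ∑ v ∈ P, f.coeff v • phi W α μ v ∈ semigroupAlg S ⊓ fixedSubalgebra W := by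
        refine sum_mem fun v hv' => ?_
        have hm : phi W α μ v ∈ semigroupAlg S ⊓ fixedSubalgebra W :=
          ⟨hphiS v (hPT v hv'), C.phi_fixed (hDI v (hPT v hv'))⟩
        exact Subalgebra.smul_mem _ hm _
      have hgoal : f - ∑ v ∈ P, f.coeff v • phi W α μ v ∈ L.range := by
        refine ih _ (sub_mem hf hq') ?_
        intro x hx hxd
        by_contra! hcon
        apply hx
        have hzero : ∀ v ∈ P, v ≠ x → (phi W α μ v).coeff x = 0 := by
          intro v hvP hne
          by_contra h
          have h1 := hgap v x hxd hne.symm ((C.lead_phi v).2 _ h)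
          obtain ⟨h2, h3⟩ := Finset.mem_filter.1 hvP
          have h4 := hv v (Finsupp.mem_support_iff.1 h2) h3
          push_cast at h4
          linarith
        simp only [AddMonoidAlgebra.coeff_sub, AddMonoidAlgebra.coeff_sum, Finsupp.sub_apply,
          Finsupp.finsetSum_apply, AddMonoidAlgebra.coeff_smul, Finsupp.smul_apply, smul_eq_mul]
        rw [Finset.sum_eq_single x, (C.lead_phi x).1, mul_one, sub_self]
        · intro b hb hbx; rw [hzero b hb hbx, mul_zero]
        · intro hxP
          have : f.coeff x = 0 := by
            by_contra h
            exact hxP (Finset.mem_filter.2 ⟨Finsupp.mem_support_iff.2 h, hxd⟩)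
          rw [this, zero_mul]
      have := add_mem hgoal hq
      rwa [sub_add_cancel] at this
  have hrange : L.range = semigroupAlg S ⊓ fixedSubalgebra W := by
    apply le_antisymm
    · rintro _ ⟨f, rfl⟩
      induction f using AddMonoidAlgebra.induction_linear with
      | zero => simp
      | add f g hf hg =>
        have := add_mem hf hg
        rwa [← map_add] at this
      | single u c =>
        have : L (AddMonoidAlgebra.single u c) ∈ semigroupAlg S ⊓ fixedSubalgebra W := by
          rw [hLs]
          have hm : phi W α μ (u : V) ∈ semigroupAlg S ⊓ fixedSubalgebra W :=
            ⟨hphiS u u.2, C.phi_fixed (hDI u u.2)⟩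
          exact Subalgebra.smul_mem _ hm _
        exact this
    · intro f hf
      obtain ⟨B, hB⟩ : ∃ B : ℝ, ∀ v ∈ f.coeff.support, ⟪v, v⟫ ≤ B := by
        obtain ⟨B, hB⟩ := (f.coeff.support.image fun v => ⟪v, v⟫).bddAbove
        exact ⟨B, fun v hv => hB (by exact_mod_cast Finset.mem_image_of_mem _ hv)⟩
      obtain ⟨n, hn⟩ := exists_nat_gt (B / δ)
      refine hsurj n f hf fun v hv _ => ?_
      have := hB v (Finsupp.mem_support_iff.2 hv)
      rw [div_lt_iff₀ hδ] at hn
      linarith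
  have hincl : Function.Injective (AddMonoidAlgebra.mapDomainAlgHom ℤ ℤ T.subtype) :=
    AddMonoidAlgebra.mapDomain_injective Subtype.val_injective
  have e1 := (AlgEquiv.ofInjective _ hincl).trans
    (Subalgebra.equivOfEq _ _ ((range_incl T).trans (congrArg semigroupAlg hTe)))
  have e2 := (AlgEquiv.ofInjective L hinj).trans (Subalgebra.equivOfEq _ _ hrange)
  exact ⟨e1.symm.trans e2⟩
end

section
/- Let W ⊂ GL(V) be a finite reflection group with simple system Δ = {α₁,…,α_r} and fundamental domain D. If u, v ∈ D, then u ≥ v (i.e. u − v is a nonnegative real linear combination of the simple roots) if and only if v lies in the convex hull of the orbit Wu. -/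
open scoped RealInnerProductSpace

namespace DomAux

variable {V : Type*} [NormedAddCommGroup V] [InnerProductSpace ℝ V]

/-- orthogonal reflection in `α` -/
noncomputable def S (α : V) : V ≃ₗᵢ[ℝ] V := (Submodule.span ℝ {α})ᗮ.reflection

lemma S_apply (α v : V) : S α v = v - (2 * ⟪v, α⟫ / ⟪α, α⟫) • α := by
  unfold S
  rw [Submodule.reflection_orthogonal_apply, Submodule.reflection_singleton_apply,
    real_inner_self_eq_norm_sq, real_inner_comm, ← Nat.cast_smul_eq_nsmul ℝ, smul_smul, neg_sub,
    mul_div_assoc]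
  norm_num

lemma S_S (α v : V) : S α (S α v) = v := Submodule.reflection_reflection _ v

lemma S_self (α : V) : S α α = -α :=
  Submodule.reflection_orthogonalComplement_singleton_eq_neg α

lemma S_inner (α x y : V) : ⟪S α x, y⟫ = ⟪x, S α y⟫ := by
  rw [← (S α).inner_map_map x, S_S]

lemma S_neg (α v : V) : S (-α) v = S α v := by
  simp [S_apply, neg_div]

lemma S_conj (α β x : V) : S β (S α x) = S α (S (S α β) x) := by
  rw [S_apply β, S_apply (S α β), map_sub, map_smul, S_S, (S α).inner_map_map, S_inner]

/-- action of a word -/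
noncomputable def act {r : ℕ} (Δ : Fin r → V) (L : List (Fin r)) (x : V) : V :=
  L.foldr (fun i y => S (Δ i) y) x

variable {r : ℕ} (Δ : Fin r → V)

@[simp] lemma act_nil (x : V) : act Δ [] x = x := rfl
@[simp] lemma act_cons (i : Fin r) (L : List (Fin r)) (x : V) :
    act Δ (i :: L) x = S (Δ i) (act Δ L x) := rfl
lemma act_append (L M : List (Fin r)) (x : V) :
    act Δ (L ++ M) x = act Δ L (act Δ M x) := by
  simp [act]

lemma act_reverse (L : List (Fin r)) (x : V) : act Δ L.reverse (act Δ L x) = x := by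
  induction L generalizing x with
  | nil => rfl
  | cons i L ih => simp [act_append, S_S, ih]

lemma act_inner (L : List (Fin r)) (x y : V) : ⟪act Δ L x, act Δ L y⟫ = ⟪x, y⟫ := by
  induction L with
  | nil => rfl
  | cons i L ih => simp [ih]

/-- nonnegative cone -/
def Pos (x : V) : Prop := ∃ c : Fin r → ℝ, (∀ i, 0 ≤ c i) ∧ x = ∑ i, c i • Δ i

variable {Δ}

lemma Pos.zero : Pos Δ 0 := ⟨0, by simp, by simp⟩

lemma Pos.add {x y : V} (hx : Pos Δ x) (hy : Pos Δ y) : Pos Δ (x + y) := by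
  obtain ⟨c, hc, rfl⟩ := hx
  obtain ⟨d, hd, rfl⟩ := hy
  exact ⟨c + d, fun i => add_nonneg (hc i) (hd i), by simp [add_smul, Finset.sum_add_distrib]⟩

lemma Pos.smul {x : V} {t : ℝ} (ht : 0 ≤ t) (hx : Pos Δ x) : Pos Δ (t • x) := by
  obtain ⟨c, hc, rfl⟩ := hx
  exact ⟨t • c, fun i => mul_nonneg ht (hc i), by simp [Finset.smul_sum, smul_smul]⟩

lemma Pos.simple (i : Fin r) : Pos Δ (Δ i) :=
  ⟨Pi.single i 1, fun j => by by_cases h : j = i <;> simp [Pi.single_apply, h],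
    by simp [Pi.single_apply, ite_smul]⟩

lemma Pos.inner {x d : V} (hx : Pos Δ x) (hd : d ∈ fundDomain Δ) : 0 ≤ ⟪d, x⟫ := by
  obtain ⟨c, hc, rfl⟩ := hx
  rw [inner_sum]
  refine Finset.sum_nonneg fun i _ => ?_
  rw [inner_smul_right]
  exact mul_nonneg (hc i) (hd i)

lemma exists_coord (h : LinearIndependent ℝ Δ) :
    ∃ p : V →ₗ[ℝ] (Fin r → ℝ), ∀ i, p (Δ i) = Pi.single i 1 := by
  obtain ⟨g, hg⟩ := LinearMap.exists_leftInverse_of_injective (Fintype.linearCombination ℝ Δ)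
    (LinearMap.ker_eq_bot.2 (h.fintypeLinearCombination_injective))
  refine ⟨g, fun i => ?_⟩
  have := LinearMap.congr_fun hg (Pi.single i 1)
  simpa using this

lemma coord_sum {p : V →ₗ[ℝ] (Fin r → ℝ)} (hp : ∀ i, p (Δ i) = Pi.single i 1)
    (c : Fin r → ℝ) : p (∑ i, c i • Δ i) = c := by
  ext j
  simp [map_sum, hp, Pi.single_apply]

lemma pos_reflect {p : V →ₗ[ℝ] (Fin r → ℝ)} (hp : ∀ i, p (Δ i) = Pi.single i 1)
    {Φ : Finset V}
    (h1 : ∀ α ∈ Φ, ∀ β ∈ Φ, (∃ c : ℝ, β = c • α) → β = α ∨ β = -α)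
    (h2 : ∀ α ∈ Φ, ∀ β ∈ Φ, S α β ∈ Φ)
    (h4 : ∀ i, Δ i ∈ Φ)
    (h5 : ∀ α ∈ Φ, Pos Δ α ∨ (∃ c : Fin r → ℝ, (∀ i, c i ≤ 0) ∧ α = ∑ i, c i • Δ i))
    {β : V} (hβ : β ∈ Φ) (hpos : Pos Δ β) (j : Fin r) (hne : β ≠ Δ j) :
    Pos Δ (S (Δ j) β) := by
  rcases h5 _ (h2 _ (h4 j) _ hβ) with h | ⟨d, hd, hdeq⟩
  · exact h
  exfalso
  obtain ⟨c, hc, rfl⟩ := hpos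
  have e : p (S (Δ j) (∑ i, c i • Δ i)) = d := by rw [hdeq, coord_sum hp]
  rw [S_apply, map_sub, map_smul, coord_sum hp, hp] at e
  have hz : ∀ i, i ≠ j → c i = 0 := by
    intro i hi
    have := congrFun e i
    simp [Pi.single_apply, hi] at this
    have h3 := hd i
    have h6 := hc i
    linarith
  have hs : ∑ i, c i • Δ i = c j • Δ j := by
    rw [Finset.sum_eq_single j]
    · intro i _ hi; rw [hz i hi, zero_smul]
    · simp
  rcases h1 _ (h4 j) _ hβ ⟨_, hs⟩ with h | h
  · exact hne h
  · have h6 := congrArg p h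
    rw [coord_sum hp, map_neg, hp] at h6
    have h7 := congrFun h6 j
    simp at h7
    have := hc j
    linarith

lemma exchange {p : V →ₗ[ℝ] (Fin r → ℝ)} (hp : ∀ i, p (Δ i) = Pi.single i 1)
    {Φ : Finset V}
    (h1 : ∀ α ∈ Φ, ∀ β ∈ Φ, (∃ c : ℝ, β = c • α) → β = α ∨ β = -α)
    (h2 : ∀ α ∈ Φ, ∀ β ∈ Φ, S α β ∈ Φ)
    (h4 : ∀ i, Δ i ∈ Φ)
    (h5 : ∀ α ∈ Φ, Pos Δ α ∨ (∃ c : Fin r → ℝ, (∀ i, c i ≤ 0) ∧ α = ∑ i, c i • Δ i))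
    {u : V} (hu : u ∈ fundDomain Δ) (L : List (Fin r)) :
    ∀ β ∈ Φ, Pos Δ β → 0 ≤ ⟪act Δ L u, β⟫ ∨
      ∃ L' : List (Fin r), L'.length < L.length ∧ S β (act Δ L u) = act Δ L' u := by
  induction L with
  | nil => intro β _ hpos; exact Or.inl (hpos.inner hu)
  | cons j L ih =>
    intro β hβ hpos
    by_cases hne : β = Δ j
    · right
      exact ⟨L, by simp, by rw [hne, act_cons, S_S]⟩
    · rcases ih _ (h2 _ (h4 j) _ hβ) (pos_reflect hp h1 h2 h4 h5 hβ hpos j hne) with h | ⟨L', hl, he⟩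
      · left; rwa [act_cons, S_inner]
      · right
        exact ⟨j :: L', by simpa using hl, by rw [act_cons, S_conj, he, act_cons]⟩

lemma sub_act {p : V →ₗ[ℝ] (Fin r → ℝ)} (hp : ∀ i, p (Δ i) = Pi.single i 1)
    {Φ : Finset V}
    (h1 : ∀ α ∈ Φ, ∀ β ∈ Φ, (∃ c : ℝ, β = c • α) → β = α ∨ β = -α)
    (h2 : ∀ α ∈ Φ, ∀ β ∈ Φ, S α β ∈ Φ)
    (h4 : ∀ i, Δ i ∈ Φ)
    (h5 : ∀ α ∈ Φ, Pos Δ α ∨ (∃ c : Fin r → ℝ, (∀ i, c i ≤ 0) ∧ α = ∑ i, c i • Δ i))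
    {u : V} (hu : u ∈ fundDomain Δ) (n : ℕ) :
    ∀ L : List (Fin r), L.length = n → Pos Δ (u - act Δ L u) := by
  induction n using Nat.strong_induction_on with
  | _ n ih =>
    intro L hL
    cases L with
    | nil => simpa using Pos.zero
    | cons j L =>
      rcases exchange hp h1 h2 h4 h5 hu L (Δ j) (h4 j) (Pos.simple j) with h | ⟨L', hl, he⟩
      · have h6 := ih L.length (by simp at hL; omega) L rfl
        have h7 : u - act Δ (j :: L) u = (u - act Δ L u) +
            (2 * ⟪act Δ L u, Δ j⟫ / ⟪Δ j, Δ j⟫) • Δ j := by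
          rw [act_cons, S_apply]; abel
        rw [h7]
        exact h6.add (Pos.smul (div_nonneg (by linarith) real_inner_self_nonneg) (Pos.simple j))
      · rw [act_cons, he]
        exact ih L'.length (by simp at hL; omega) L' rfl

/-- root reflections are words -/
lemma root_word {p : V →ₗ[ℝ] (Fin r → ℝ)} (hp : ∀ i, p (Δ i) = Pi.single i 1)
    {Φ : Finset V} (h0 : (0 : V) ∉ Φ)
    (h1 : ∀ α ∈ Φ, ∀ β ∈ Φ, (∃ c : ℝ, β = c • α) → β = α ∨ β = -α)
    (h2 : ∀ α ∈ Φ, ∀ β ∈ Φ, S α β ∈ Φ)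
    (h4 : ∀ i, Δ i ∈ Φ)
    (h5 : ∀ α ∈ Φ, Pos Δ α ∨ (∃ c : Fin r → ℝ, (∀ i, c i ≤ 0) ∧ α = ∑ i, c i • Δ i))
    {β : V} (hβ : β ∈ Φ) (hpos : Pos Δ β) : ∃ L, ∀ x, S β x = act Δ L x := by
  classical
  by_contra hcon
  obtain ⟨γ, hγ, hmin⟩ := Finset.exists_min_image
    (Φ.filter fun β => Pos Δ β ∧ ¬ ∃ L, ∀ x, S β x = act Δ L x) (fun x => ∑ i, p x i)
    ⟨β, by simp only [Finset.mem_filter]; exact ⟨hβ, hpos, hcon⟩⟩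
  simp only [Finset.mem_filter] at hγ hmin
  obtain ⟨hγΦ, hγpos, hγno⟩ := hγ
  have hγ0 : γ ≠ 0 := fun h => h0 (h ▸ hγΦ)
  obtain ⟨i, hi⟩ : ∃ i, 0 < ⟪γ, Δ i⟫ := by
    by_contra hno
    push Not at hno
    obtain ⟨c, hc, hceq⟩ := hγpos
    have h6 : 0 < ⟪γ, γ⟫ := real_inner_self_pos.2 hγ0
    have h7 : ⟪γ, γ⟫ = ∑ i, c i * ⟪γ, Δ i⟫ := by
      conv_lhs => rw [show ⟪γ, γ⟫ = ⟪γ, ∑ i, c i • Δ i⟫ from congrArg _ hceq]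
      rw [inner_sum]
      exact Finset.sum_congr rfl fun i _ => by rw [real_inner_smul_right]
    have h8 : ∑ i, c i * ⟪γ, Δ i⟫ ≤ 0 :=
      Finset.sum_nonpos fun i _ => mul_nonpos_of_nonneg_of_nonpos (hc i) (hno i)
    linarith
  by_cases hne : γ = Δ i
  · exact hγno ⟨[i], fun x => by rw [hne]; rfl⟩
  have hpos' := pos_reflect hp h1 h2 h4 h5 hγΦ hγpos i hne
  have hin := h2 _ (h4 i) _ hγΦ
  have hw : ¬ ∃ L, ∀ x, S (S (Δ i) γ) x = act Δ L x := by
    rintro ⟨L, hL⟩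
    refine hγno ⟨i :: (L ++ [i]), fun x => ?_⟩
    rw [act_cons, act_append, ← hL, act_cons, act_nil, ← S_conj, S_S]
  have h9 := hmin _ ⟨hin, hpos', hw⟩
  have hd0 : Δ i ≠ 0 := fun h => h0 (h ▸ h4 i)
  have h10 : 0 < 2 * ⟪γ, Δ i⟫ / ⟪Δ i, Δ i⟫ := div_pos (by linarith) (real_inner_self_pos.2 hd0)
  rw [S_apply, map_sub, map_smul, hp] at h9
  simp [Finset.sum_sub_distrib, Pi.single_apply] at h9
  rw [real_inner_self_eq_norm_sq] at h10
  linarith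

lemma exists_dom {p : V →ₗ[ℝ] (Fin r → ℝ)} (hp : ∀ i, p (Δ i) = Pi.single i 1)
    (W : Subgroup (V ≃ₗ[ℝ] V)) [Finite W] (hs : ∀ i, (S (Δ i)).toLinearEquiv ∈ W)
    (hd0 : ∀ i, Δ i ≠ 0) (x : V) : ∃ w ∈ W, w x ∈ fundDomain Δ := by
  obtain ⟨w, hw⟩ := Finite.exists_max (fun w : W => ∑ i, p ((w : V ≃ₗ[ℝ] V) x) i)
  refine ⟨w, w.2, fun i => ?_⟩
  have h := hw ⟨_, W.mul_mem (hs i) w.2⟩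
  simp only [LinearEquiv.mul_apply, LinearIsometryEquiv.coe_toLinearEquiv] at h
  rw [S_apply, map_sub, map_smul, hp] at h
  simp [Finset.sum_sub_distrib, Pi.single_apply] at h
  by_contra hneg
  push Not at hneg
  have := div_neg_of_neg_of_pos (by linarith : 2 * ⟪(w : V ≃ₗ[ℝ] V) x, Δ i⟫ < 0)
    (real_inner_self_pos.2 (hd0 i))
  rw [real_inner_self_eq_norm_sq] at this
  linarith

end DomAux

theorem dominance_iff_mem_convexHull_orbit
    {V : Type*} [NormedAddCommGroup V] [InnerProductSpace ℝ V] [FiniteDimensional ℝ V]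
    (W : Subgroup (V ≃ₗ[ℝ] V)) [Finite W] (hW : IsReflectionGroup W)
    {r : ℕ} (Δ : Fin r → V) (hΔ : IsSimpleSystem W Δ)
    (u v : V) (hu : u ∈ fundDomain Δ) (hv : v ∈ fundDomain Δ) :
    (∃ c : Fin r → ℝ, (∀ i, 0 ≤ c i) ∧ u - v = ∑ i, c i • Δ i) ↔
      v ∈ convexHull ℝ {x : V | ∃ w ∈ W, (w : V ≃ₗ[ℝ] V) u = x} := by
  obtain ⟨hli, Φ, h0, h1, h2, h3, h4, h5⟩ := hΔ
  obtain ⟨p, hp⟩ := DomAux.exists_coord hli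
  replace h2 : ∀ α ∈ Φ, ∀ β ∈ Φ, DomAux.S α β ∈ Φ := fun α ha β hb => by
    rw [DomAux.S_apply]; exact h2 α ha β hb
  have hd0 : ∀ i, Δ i ≠ 0 := fun i h => h0 (h ▸ h4 i)
  have hs : ∀ i, (DomAux.S (Δ i)).toLinearEquiv ∈ W := fun i => by
    rw [← h3]
    exact Subgroup.subset_closure ⟨Δ i, h4 i, hd0 i, fun x => DomAux.S_apply _ _⟩
  have hword : ∀ w ∈ W, ∃ L, ∀ x, w x = DomAux.act Δ L x := by
    intro w hw
    rw [← h3] at hw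
    induction hw using Subgroup.closure_induction with
    | mem g hg =>
      obtain ⟨α, hα, -, hg⟩ := hg
      have hg' : ∀ x, g x = DomAux.S α x := fun x => by rw [hg, DomAux.S_apply]
      rcases h5 α hα with h | ⟨c, hc, hceq⟩
      · obtain ⟨L, hL⟩ := DomAux.root_word hp h0 h1 h2 h4 h5 hα h
        exact ⟨L, fun x => by rw [hg', hL]⟩
      · have hm : -α ∈ Φ := by
          have := h2 α hα α hα
          rwa [DomAux.S_self] at this
        obtain ⟨L, hL⟩ := DomAux.root_word hp h0 h1 h2 h4 h5 hm
          ⟨-c, fun i => by simpa using hc i, by rw [hceq]; simp⟩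
        exact ⟨L, fun x => by rw [hg', ← hL, DomAux.S_neg]⟩
    | one => exact ⟨[], fun x => rfl⟩
    | mul a b _ _ ha hb =>
      obtain ⟨L, hL⟩ := ha
      obtain ⟨M, hM⟩ := hb
      exact ⟨L ++ M, fun x => by rw [DomAux.act_append, ← hM, ← hL]; rfl⟩
    | inv a _ ha =>
      obtain ⟨L, hL⟩ := ha
      refine ⟨L.reverse, fun x => ?_⟩
      have h6 : a (a⁻¹ x) = x := a.apply_symm_apply x
      rw [hL] at h6
      conv_rhs => rw [← h6]
      rw [DomAux.act_reverse]
  have hB : ∀ y ∈ fundDomain Δ, ∀ w ∈ W, DomAux.Pos Δ (y - w y) := by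
    intro y hy w hw
    obtain ⟨L, hL⟩ := hword w hw
    rw [hL]
    exact DomAux.sub_act hp h1 h2 h4 h5 hy _ L rfl
  change DomAux.Pos Δ (u - v) ↔ _
  constructor
  · intro huv
    by_contra hnot
    have hfin : {x : V | ∃ w ∈ W, (w : V ≃ₗ[ℝ] V) u = x}.Finite := by
      have : {x : V | ∃ w ∈ W, (w : V ≃ₗ[ℝ] V) u = x} =
          Set.range (fun w : W => (w : V ≃ₗ[ℝ] V) u) := by
        ext x; simp
      rw [this]
      exact Set.finite_range _
    obtain ⟨f, t, hf1, hf2⟩ := geometric_hahn_banach_closed_point (convex_convexHull ℝ _)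
      (hfin.isClosed_convexHull ℝ) hnot
    obtain ⟨x, rfl⟩ := (InnerProductSpace.toDual ℝ V).surjective f
    simp only [InnerProductSpace.toDual_apply_apply] at hf1 hf2
    obtain ⟨w, hw, hd⟩ := DomAux.exists_dom hp W hs hd0 x
    obtain ⟨L, hL⟩ := hword w hw
    have hiso : ∀ a b, ⟪w a, w b⟫ = ⟪a, b⟫ := fun a b => by
      rw [hL, hL, DomAux.act_inner]
    have e1 := (hB v hv w hw).inner hd
    have e2 := huv.inner hd
    rw [inner_sub_right] at e1 e2
    rw [hiso] at e1
    have e3 := hf1 (w⁻¹ u) (subset_convexHull ℝ _ ⟨w⁻¹, W.inv_mem hw, rfl⟩)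
    have h6 : w (w⁻¹ u) = u := w.apply_symm_apply u
    rw [← hiso, h6] at e3
    linarith
  · intro hmem
    have hconv : Convex ℝ {x : V | DomAux.Pos Δ (u - x)} := by
      intro a ha b hb s t hs ht hst
      have : u - (s • a + t • b) = s • (u - a) + t • (u - b) := by
        have : u = (s + t) • u := by rw [hst, one_smul]
        conv_lhs => rw [this]
        module
      simp only [Set.mem_ofPred_eq] at *
      rw [this]
      exact (DomAux.Pos.smul hs ha).add (DomAux.Pos.smul ht hb)
    refine convexHull_min ?_ hconv hmem
    rintro x ⟨w, hw, rfl⟩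
    exact hB u hu w hw
end

section
/- Let W ⊂ GL(V) be a finite reflection group that preserves a lattice M ⊂ V. Then there exists a simple system Δ for W such that Δ ⊂ M ⊂ Λ, where Λ is the weight group associated to Δ. Moreover, the action of W preserves Λ. -/
open scoped RealInnerProductSpace

lemma auxA {E ι : Type*} [NormedAddCommGroup E] [InnerProductSpace ℝ E] [FiniteDimensional ℝ E]
    [Finite ι] (a : ι → E) (ha : Function.Injective a) (h0 : ∀ i, a i ≠ 0)
    (hsp : Submodule.span ℝ (Set.range a) = ⊤)
    (hcl : ∀ i j, ∃ k, a k = a j - (2 * ⟪a j, a i⟫ / ⟪a i, a i⟫) • a i)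
    (hint : ∀ i j, ∃ n : ℤ, 2 * ⟪a i, a j⟫ / ⟪a j, a j⟫ = (n : ℝ))
    (hred : ∀ i j, ∀ c : ℝ, a j = c • a i → a j = a i ∨ a j = - a i) :
    ∃ s : Finset ι, LinearIndepOn ℝ a (s : Set ι) ∧
      (∀ i, a i ∈ AddSubmonoid.closure (a '' s) ∨ -a i ∈ AddSubmonoid.closure (a '' s)) ∧
      (∀ i, (2 / ⟪a i, a i⟫) • a i ∈
        Submodule.span ℤ ((fun i => (2 / ⟪a i, a i⟫) • a i) '' (s : Set ι))) := by
  have hn : ∀ i, ⟪a i, a i⟫ ≠ 0 := fun i => by simpa using h0 i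
  have hinj : Function.Injective (innerₗ E : E →ₗ[ℝ] E →ₗ[ℝ] ℝ) := by
    intro x y h
    refine ext_inner_right ℝ fun v => ?_
    simpa using congrArg (fun f => f v) h
  have hinj' : Function.Injective (innerₗ E : E →ₗ[ℝ] E →ₗ[ℝ] ℝ).flip := by
    intro x y h
    refine ext_inner_left ℝ fun v => ?_
    have := congrArg (fun f => f v) h
    simpa only [LinearMap.flip_apply, innerₗ_apply_apply] using this
  have : (innerₗ E : E →ₗ[ℝ] E →ₗ[ℝ] ℝ).IsPerfPair := .of_injective hinj hinj'
  let co : ι ↪ E := ⟨fun i => (2 / ⟪a i, a i⟫) • a i, by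
    intro i j h
    have hi := hn i
    have hj := hn j
    have h1 : a i = ((2 / ⟪a i, a i⟫)⁻¹ * (2 / ⟪a j, a j⟫)) • a j := by
      rw [mul_smul]
      simp only at h
      rw [← h, smul_smul, inv_mul_cancel₀ (by positivity), one_smul]
    rcases hred j i _ h1 with h2 | h2
    · exact ha h2
    · exfalso
      simp only [h2, inner_neg_neg] at h
      have h3 : (4 / ⟪a j, a j⟫) • a j = 0 := by
        have : (2 / ⟪a j, a j⟫) • a j + (2 / ⟪a j, a j⟫) • a j = 0 := by
          nth_rewrite 1 [← h]; simp
        rw [← add_smul] at this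
        rw [← this]; congr 1; ring
      rcases smul_eq_zero.mp h3 with h4 | h4
      · have : (4 / ⟪a j, a j⟫) ≠ 0 := by positivity
        exact this h4
      · exact h0 j h4⟩
  have hco : ∀ i, co i = (2 / ⟪a i, a i⟫) • a i := fun i => rfl
  have hpair : ∀ x i, (innerₗ E : E →ₗ[ℝ] E →ₗ[ℝ] ℝ) x (co i) = 2 * ⟪x, a i⟫ / ⟪a i, a i⟫ := by
    intro x i
    rw [hco, innerₗ_apply_apply, real_inner_smul_right]; ring
  have hp : ∀ i, (innerₗ E : E →ₗ[ℝ] E →ₗ[ℝ] ℝ) ((⟨a, ha⟩ : ι ↪ E) i) (co i) = 2 := by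
    intro i
    rw [hpair]
    have := hn i
    simp only [Function.Embedding.coeFn_mk]
    field_simp
  have hs : ∀ i, Set.MapsTo (Module.preReflection ((⟨a, ha⟩ : ι ↪ E) i)
      ((innerₗ E : E →ₗ[ℝ] E →ₗ[ℝ] ℝ).flip (co i)))
      (Set.range (⟨a, ha⟩ : ι ↪ E)) (Set.range (⟨a, ha⟩ : ι ↪ E)) := by
    rintro i _ ⟨j, rfl⟩
    obtain ⟨k, hk⟩ := hcl i j
    refine ⟨k, ?_⟩
    rw [Module.preReflection_apply, LinearMap.flip_apply, hpair]
    exact hk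
  have hI : ∀ i j, ∃ z : ℤ, z = (innerₗ E : E →ₗ[ℝ] E →ₗ[ℝ] ℝ) ((⟨a, ha⟩ : ι ↪ E) i) (co j) := by
    intro i j
    obtain ⟨n, h⟩ := hint i j
    exact ⟨n, by rw [hpair]; exact h.symm⟩
  let P := RootPairing.mk'' (innerₗ E : E →ₗ[ℝ] E →ₗ[ℝ] ℝ) ⟨a, ha⟩ co hp hs hsp
  have : P.IsRootSystem := RootPairing.isRootSystem_mk'' hI
  have : P.IsCrystallographic := ⟨hI⟩
  have : P.IsReduced := ⟨by
    intro i j h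
    change ¬ LinearIndependent ℝ ![a i, a j] at h
    change a i = a j ∨ a i = - a j
    rw [LinearIndependent.pair_iff' (h0 i)] at h
    push Not at h
    obtain ⟨c, hc⟩ := h
    rcases hred i j c hc.symm with h | h
    · exact Or.inl h.symm
    · right; rw [h, neg_neg]⟩
  obtain ⟨b⟩ := P.nonempty_base
  exact ⟨b.support, b.linearIndepOn_root, b.root_mem_or_neg_mem, b.coroot_mem_span_int⟩

lemma auxB {E ι : Type*} [NormedAddCommGroup E] [InnerProductSpace ℝ E] [FiniteDimensional ℝ E]
    [Finite ι] (a : ι → E) (ha : Function.Injective a) (h0 : ∀ i, a i ≠ 0)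
    (hcl : ∀ i j, ∃ k, a k = a j - (2 * ⟪a j, a i⟫ / ⟪a i, a i⟫) • a i)
    (hint : ∀ i j, ∃ n : ℤ, 2 * ⟪a i, a j⟫ / ⟪a j, a j⟫ = (n : ℝ))
    (hred : ∀ i j, ∀ c : ℝ, a j = c • a i → a j = a i ∨ a j = - a i) :
    ∃ s : Finset ι, LinearIndepOn ℝ a (s : Set ι) ∧
      (∀ i, a i ∈ AddSubmonoid.closure (a '' s) ∨ -a i ∈ AddSubmonoid.closure (a '' s)) ∧
      (∀ i, (2 / ⟪a i, a i⟫) • a i ∈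
        Submodule.span ℤ ((fun i => (2 / ⟪a i, a i⟫) • a i) '' (s : Set ι))) := by
  let U := Submodule.span ℝ (Set.range a)
  let a' : ι → U := fun i => ⟨a i, Submodule.subset_span ⟨i, rfl⟩⟩
  have key := auxA a' (fun i j h => ha (congrArg Subtype.val h))
    (fun i h => h0 i (congrArg Subtype.val h))
    (Submodule.span_range_subtype_eq_top_iff U (fun i => Submodule.subset_span ⟨i, rfl⟩) |>.2 rfl)
    (fun i j => by obtain ⟨k, hk⟩ := hcl i j; exact ⟨k, Subtype.ext hk⟩)
    (fun i j => hint i j)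
    (fun i j c h => by
      rcases hred i j c (congrArg Subtype.val h) with h | h
      · exact Or.inl (Subtype.ext h)
      · exact Or.inr (Subtype.ext h))
  obtain ⟨s, h1, h2, h3⟩ := key
  refine ⟨s, ?_, ?_, ?_⟩
  · exact h1.map_injOn U.subtype (Subtype.val_injective.injOn)
  · have : a '' s = U.subtype.toAddMonoidHom '' (a' '' s) := by
      rw [← Set.image_comp]; rfl
    intro i
    rw [this, ← AddMonoidHom.map_mclosure]
    exact (h2 i).imp (fun h => ⟨_, h, rfl⟩) (fun h => ⟨_, h, rfl⟩)
  · have : (fun i => (2 / ⟪a i, a i⟫) • a i) '' (s : Set ι) =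
      (U.subtype.restrictScalars ℤ) '' ((fun i => (2 / ⟪a' i, a' i⟫) • a' i) '' (s : Set ι)) := by
      rw [← Set.image_comp]; rfl
    intro i
    rw [this, Submodule.span_image]
    exact ⟨_, h3 i, rfl⟩

lemma auxC {V : Type*} [NormedAddCommGroup V] [InnerProductSpace ℝ V]
    (M : Submodule ℤ V) (hM : IsLattice M) (α : V) (hα : α ≠ 0) :
    ∃ β ∈ M, (∃ c : ℝ, β = c • α) ∧ ∀ c : ℝ, c • α ∈ M → ∃ n : ℤ, c • α = n • β := by
  classical
  obtain ⟨b, hli, hsp, rfl⟩ := hM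
  let B : Module.Basis b ℝ V := Module.Basis.mk hli (by simp [hsp])
  obtain ⟨k, hk⟩ : ∃ k, B.repr α k ≠ 0 := by
    by_contra! h
    exact hα (B.repr.map_eq_zero_iff.mp (Finsupp.ext h))
  have hi : ∀ m ∈ Submodule.span ℤ b, ∃ n : ℤ, B.repr m k = n := by
    intro m hm
    induction hm using Submodule.span_induction with
    | mem x hx =>
      have : B.repr x = Finsupp.single ⟨x, hx⟩ 1 := by
        have : x = B ⟨x, hx⟩ := by simp [B]
        conv_lhs => rw [this]
        simp
      rw [this, Finsupp.single_apply]
      split_ifs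
      · exact ⟨1, by simp⟩
      · exact ⟨0, by simp⟩
    | zero => exact ⟨0, by simp⟩
    | add x y _ _ hx hy =>
      obtain ⟨n, hn⟩ := hx
      obtain ⟨m, hm⟩ := hy
      exact ⟨n + m, by simp [hn, hm]⟩
    | smul c x _ hx =>
      obtain ⟨n, hn⟩ := hx
      exact ⟨c * n, by rw [← Int.cast_smul_eq_zsmul ℝ]; simp [hn]⟩
  let I : AddSubgroup ℤ :=
    { carrier := {n | ∃ c : ℝ, c • α ∈ Submodule.span ℤ b ∧ B.repr (c • α) k = n}
      zero_mem' := ⟨0, by simp⟩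
      add_mem' := by
        rintro n m ⟨c, hc, h⟩ ⟨d, hd, h'⟩
        refine ⟨c + d, ?_, ?_⟩
        · rw [add_smul]; exact add_mem hc hd
        · rw [add_smul, map_add, Finsupp.add_apply, h, h']; simp
      neg_mem' := by
        rintro n ⟨c, hc, h⟩
        refine ⟨-c, ?_, ?_⟩
        · rw [neg_smul]; exact neg_mem hc
        · rw [neg_smul, map_neg, Finsupp.neg_apply, h]; simp }
  obtain ⟨g, hg⟩ := Int.subgroup_cyclic I
  have hgI : g ∈ I := by rw [hg]; exact AddSubgroup.subset_closure rfl
  obtain ⟨c0, hc0, hc0'⟩ := hgI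
  refine ⟨c0 • α, hc0, ⟨c0, rfl⟩, fun c hc => ?_⟩
  obtain ⟨n, hn⟩ := hi _ hc
  have : n ∈ I := ⟨c, hc, hn⟩
  rw [hg, AddSubgroup.mem_closure_singleton] at this
  obtain ⟨m, hm⟩ := this
  refine ⟨m, ?_⟩
  rw [← Int.cast_smul_eq_zsmul ℝ, smul_smul]
  congr 1
  rw [← hm] at hn
  simp only [map_smul, Finsupp.smul_apply, smul_eq_mul, Int.cast_mul] at hn hc0'
  apply mul_right_cancel₀ hk
  rw [hn, mul_assoc, hc0']

lemma refl_invol {V : Type*} [NormedAddCommGroup V] [InnerProductSpace ℝ V]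
    {g : V ≃ₗ[ℝ] V} {α : V} (h : IsReflectionBy g α) (v : V) : g (g v) = v := by
  have hn : ⟪α, α⟫ ≠ 0 := by simpa using h.1
  rw [h.2 (g v), h.2 v, inner_sub_left, real_inner_smul_left, sub_sub, ← add_smul]
  have : 2 * ⟪v, α⟫ / ⟪α, α⟫ + 2 * (⟪v, α⟫ - 2 * ⟪v, α⟫ / ⟪α, α⟫ * ⟪α, α⟫) / ⟪α, α⟫ = 0 := by
    field_simp; ring
  rw [this]; simp

lemma refl_inner {V : Type*} [NormedAddCommGroup V] [InnerProductSpace ℝ V]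
    {g : V ≃ₗ[ℝ] V} {α : V} (h : IsReflectionBy g α) (u v : V) : ⟪g u, g v⟫ = ⟪u, v⟫ := by
  have hn : ⟪α, α⟫ ≠ 0 := by simpa using h.1
  rw [h.2 u, h.2 v]
  simp only [inner_sub_left, inner_sub_right, real_inner_smul_left, real_inner_smul_right]
  rw [real_inner_comm v α]
  field_simp; ring

lemma refl_conj {V : Type*} [NormedAddCommGroup V] [InnerProductSpace ℝ V]
    {g h : V ≃ₗ[ℝ] V} {α β : V} (hg : IsReflectionBy g α) (hh : IsReflectionBy h β) :
    IsReflectionBy (g * h * g) (g β) := by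
  refine ⟨by simpa using hh.1, fun v => ?_⟩
  change g (h (g v)) = _
  rw [hh.2, map_sub, map_smul, refl_invol hg, refl_inner hg, ← refl_inner hg (g v) β,
    refl_invol hg]

lemma refl_smul {V : Type*} [NormedAddCommGroup V] [InnerProductSpace ℝ V]
    {g : V ≃ₗ[ℝ] V} {α : V} (h : IsReflectionBy g α) {c : ℝ} (hc : c ≠ 0) :
    IsReflectionBy g (c • α) := by
  have hn : ⟪α, α⟫ ≠ 0 := by simpa using h.1
  refine ⟨by simp [hc, h.1], fun v => ?_⟩
  rw [h.2, smul_smul]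
  simp only [real_inner_smul_left, real_inner_smul_right]
  congr 2
  field_simp

/-- primitive roots -/
def PrimRoot {V : Type*} [NormedAddCommGroup V] [InnerProductSpace ℝ V]
    (W : Subgroup (V ≃ₗ[ℝ] V)) (M : Submodule ℤ V) (β : V) : Prop :=
  (∃ g ∈ W, IsReflectionBy g β) ∧ β ∈ M ∧ ∀ c : ℝ, c • β ∈ M → ∃ n : ℤ, c = n

lemma prim_red {V : Type*} [NormedAddCommGroup V] [InnerProductSpace ℝ V]
    {W : Subgroup (V ≃ₗ[ℝ] V)} {M : Submodule ℤ V} {α β : V} (hα : PrimRoot W M α)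
    (hβ : PrimRoot W M β) {c : ℝ} (h : β = c • α) : β = α ∨ β = -α := by
  have hc : c ≠ 0 := by
    rintro rfl
    obtain ⟨g, -, hg⟩ := hβ.1
    exact hg.1 (by simpa using h)
  have h' : α = c⁻¹ • β := by rw [h, smul_smul, inv_mul_cancel₀ hc, one_smul]
  obtain ⟨n, hn⟩ := hα.2.2 c (h ▸ hβ.2.1)
  obtain ⟨m, hm⟩ := hβ.2.2 c⁻¹ (h' ▸ hα.2.1)
  have : n * m = 1 := by
    have : (n : ℝ) * m = 1 := by rw [← hn, ← hm, mul_inv_cancel₀ hc]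
    exact_mod_cast this
  rcases Int.eq_one_or_neg_one_of_mul_eq_one this with rfl | rfl
  · left; rw [h, hn]; simp
  · right; rw [h, hn]; simp

lemma prim_exists {V : Type*} [NormedAddCommGroup V] [InnerProductSpace ℝ V]
    {W : Subgroup (V ≃ₗ[ℝ] V)} {M : Submodule ℤ V} (hM : IsLattice M)
    (hWM : ∀ w ∈ W, ∀ m ∈ M, (w : V ≃ₗ[ℝ] V) m ∈ M) {g : V ≃ₗ[ℝ] V} (hgW : g ∈ W)
    {α : V} (hg : IsReflectionBy g α) : ∃ β, PrimRoot W M β ∧ IsReflectionBy g β := by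
  have hn : ⟪α, α⟫ ≠ 0 := by simpa using hg.1
  obtain ⟨β, hβM, ⟨c, hc⟩, hβ⟩ := auxC M hM α hg.1
  have hβ0 : β ≠ 0 := by
    rintro rfl
    have hz : ∀ m ∈ M, ⟪m, α⟫ = 0 := by
      intro m hm
      have h1 : (2 * ⟪m, α⟫ / ⟪α, α⟫) • α ∈ M := by
        have : (2 * ⟪m, α⟫ / ⟪α, α⟫) • α = m - g m := by rw [hg.2]; abel
        rw [this]
        exact sub_mem hm (hWM g hgW m hm)
      obtain ⟨n, hn'⟩ := hβ _ h1
      rw [smul_zero] at hn'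
      rcases smul_eq_zero.mp hn' with h | h
      · field_simp at h
        simpa using h
      · exact absurd h hg.1
    obtain ⟨b, -, hsp, rfl⟩ := hM
    have : α ∈ Submodule.span ℝ b := by rw [hsp]; trivial
    apply hn
    have hle : Submodule.span ℝ b ≤ LinearMap.ker ((innerₗ V : V →ₗ[ℝ] V →ₗ[ℝ] ℝ).flip α) := by
      rw [Submodule.span_le]
      intro x hx
      have := hz x (Submodule.subset_span hx)
      simpa only [SetLike.mem_coe, LinearMap.mem_ker, LinearMap.flip_apply, innerₗ_apply_apply] using this
    simpa only [LinearMap.mem_ker, LinearMap.flip_apply, innerₗ_apply_apply] using hle this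
  have hc0 : c ≠ 0 := by
    rintro rfl
    exact hβ0 (by simpa using hc)
  have hgβ : IsReflectionBy g β := hc ▸ refl_smul hg hc0
  refine ⟨β, ⟨⟨g, hgW, hgβ⟩, hβM, fun d hd => ?_⟩, hgβ⟩
  obtain ⟨n, hn'⟩ := hβ (d * c) (by rw [mul_smul, ← hc]; exact hd)
  rw [mul_smul, ← hc, ← Int.cast_smul_eq_zsmul ℝ] at hn'
  exact ⟨n, smul_left_injective ℝ hβ0 hn'⟩

lemma prim_int {V : Type*} [NormedAddCommGroup V] [InnerProductSpace ℝ V]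
    {W : Subgroup (V ≃ₗ[ℝ] V)} {M : Submodule ℤ V}
    (hWM : ∀ w ∈ W, ∀ m ∈ M, (w : V ≃ₗ[ℝ] V) m ∈ M) {β : V} (hβ : PrimRoot W M β)
    {m : V} (hm : m ∈ M) : ∃ n : ℤ, 2 * ⟪m, β⟫ / ⟪β, β⟫ = (n : ℝ) := by
  obtain ⟨⟨g, hgW, hg⟩, -, h⟩ := hβ
  apply h
  have : (2 * ⟪m, β⟫ / ⟪β, β⟫) • β = m - g m := by rw [hg.2]; abel
  rw [this]
  exact sub_mem hm (hWM g hgW m hm)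

lemma prim_closed {V : Type*} [NormedAddCommGroup V] [InnerProductSpace ℝ V]
    {W : Subgroup (V ≃ₗ[ℝ] V)} {M : Submodule ℤ V}
    (hWM : ∀ w ∈ W, ∀ m ∈ M, (w : V ≃ₗ[ℝ] V) m ∈ M) {α β : V} (hα : PrimRoot W M α)
    (hβ : PrimRoot W M β) : PrimRoot W M (β - (2 * ⟪β, α⟫ / ⟪α, α⟫) • α) := by
  obtain ⟨⟨g, hgW, hg⟩, -, -⟩ := hα
  obtain ⟨⟨h, hhW, hh⟩, hβM, hβ'⟩ := hβ
  rw [← hg.2]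
  refine ⟨⟨g * h * g, mul_mem (mul_mem hgW hhW) hgW, refl_conj hg hh⟩, hWM g hgW β hβM, ?_⟩
  intro c hc
  apply hβ'
  have := hWM g hgW _ hc
  rwa [map_smul, refl_invol hg] at this

lemma prim_finite {V : Type*} [NormedAddCommGroup V] [InnerProductSpace ℝ V]
    (W : Subgroup (V ≃ₗ[ℝ] V)) [Finite W] (M : Submodule ℤ V) :
    {β | PrimRoot W M β}.Finite := by
  have h : {β | PrimRoot W M β} ⊆ ⋃ g : W, {β | PrimRoot W M β ∧ IsReflectionBy (g : V ≃ₗ[ℝ] V) β} := by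
    intro β hβ
    obtain ⟨g, hgW, hg⟩ := hβ.1
    exact Set.mem_iUnion.mpr ⟨⟨g, hgW⟩, hβ, hg⟩
  refine (Set.finite_iUnion fun g => ?_).subset h
  by_cases hne : ∃ β, PrimRoot W M β ∧ IsReflectionBy (g : V ≃ₗ[ℝ] V) β
  · obtain ⟨α, hα, hgα⟩ := hne
    refine (Set.toFinite {α, -α}).subset ?_
    rintro β ⟨hβ, hgβ⟩
    have h1 := hgα.2 β
    rw [hgβ.2 β] at h1
    have hn : ⟪β, β⟫ ≠ 0 := by simpa using hgβ.1
    have h2 : β = (⟪β, α⟫ / ⟪α, α⟫) • α := by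
      have h3 : (2 : ℝ) • β = (2 * ⟪β, α⟫ / ⟪α, α⟫) • α := by
        have : 2 * ⟪β, β⟫ / ⟪β, β⟫ = (2 : ℝ) := by field_simp
        rw [this] at h1
        exact sub_right_injective h1
      rw [mul_div_assoc, mul_smul] at h3
      exact smul_right_injective V (two_ne_zero : (2 : ℝ) ≠ 0) h3
    exact prim_red hα hβ h2
  · convert Set.finite_empty
    ext β
    simp only [Set.mem_ofPred_eq, Set.mem_empty_iff_false, iff_false]
    exact fun h => hne ⟨β, h⟩

lemma closure_combo {V : Type*} [AddCommGroup V] [Module ℝ V] {r : ℕ} (Δ : Fin r → V) (v : V)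
    (h : v ∈ AddSubmonoid.closure (Set.range Δ)) :
    ∃ c : Fin r → ℝ, (∀ i, 0 ≤ c i) ∧ v = ∑ i, c i • Δ i := by
  induction h using AddSubmonoid.closure_induction with
  | mem x hx =>
    obtain ⟨i, rfl⟩ := hx
    refine ⟨Pi.single i 1, fun j => ?_, ?_⟩
    · rw [Pi.single_apply]; split_ifs <;> norm_num
    · simp [Pi.single_apply]
  | zero => exact ⟨0, by simp, by simp⟩
  | add x y _ _ hx hy =>
    obtain ⟨c, hc, rfl⟩ := hx
    obtain ⟨d, hd, rfl⟩ := hy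
    exact ⟨c + d, fun i => add_nonneg (hc i) (hd i), by simp [add_smul, Finset.sum_add_distrib]⟩

theorem exists_simple_system_in_lattice
    {V : Type*} [NormedAddCommGroup V] [InnerProductSpace ℝ V] [FiniteDimensional ℝ V]
    (W : Subgroup (V ≃ₗ[ℝ] V)) [Finite W] (hW : IsReflectionGroup W)
    (M : Submodule ℤ V) (hM : IsLattice M)
    (hWM : ∀ w ∈ W, ∀ m ∈ M, (w : V ≃ₗ[ℝ] V) m ∈ M) :
    ∃ (r : ℕ) (Δ : Fin r → V), IsSimpleSystem W Δ ∧
      (∀ i, Δ i ∈ M) ∧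
      (M : Set V) ⊆ weightGroup Δ ∧
      (∀ w ∈ W, ∀ v ∈ weightGroup Δ, (w : V ≃ₗ[ℝ] V) v ∈ weightGroup Δ) := by
  have hfin := prim_finite W M
  let Φ : Set V := {β | PrimRoot W M β}
  have : Finite Φ := hfin.to_subtype
  have h0 : ∀ β, PrimRoot W M β → β ≠ 0 := by
    rintro β ⟨⟨g, -, hg⟩, -⟩
    exact hg.1
  have hWcl : Subgroup.closure {g : V ≃ₗ[ℝ] V | ∃ α, PrimRoot W M α ∧ IsReflectionBy g α} = W := by
    apply le_antisymm
    · rw [Subgroup.closure_le]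
      rintro g ⟨α, ⟨⟨h, hhW, hh⟩, -⟩, hg⟩
      have : g = h := LinearEquiv.ext fun v => by rw [hg.2, hh.2]
      rw [this]; exact hhW
    · conv_lhs => rw [← hW]
      apply Subgroup.closure_mono
      rintro g ⟨hgW, α, hg⟩
      exact prim_exists hM hWM hgW hg
  obtain ⟨s, h1, h2, h3⟩ := auxB (fun β : Φ => (β : V)) Subtype.val_injective
    (fun β => h0 β β.2)
    (fun α β => ⟨⟨_, prim_closed hWM α.2 β.2⟩, rfl⟩)
    (fun α β => prim_int hWM β.2 α.2.2.1)
    (fun α β c h => prim_red α.2 β.2 h)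
  let Δ : Fin s.card → V := fun i => ((s.equivFin.symm i : Φ) : V)
  have hΔ : ∀ i, PrimRoot W M (Δ i) := fun i => (s.equivFin.symm i : Φ).2
  have hrange : (fun β : Φ => (β : V)) '' (s : Set Φ) = Set.range Δ := by
    ext v
    constructor
    · rintro ⟨β, hβ, rfl⟩
      exact ⟨s.equivFin ⟨β, hβ⟩, by simp [Δ]⟩
    · rintro ⟨i, rfl⟩
      exact ⟨_, (s.equivFin.symm i).2, rfl⟩
  have hMΛ : (M : Set V) ⊆ weightGroup Δ := fun m hm i => prim_int hWM (hΔ i) hm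
  -- integrality of all coroots on the weight group
  have hall : ∀ v ∈ weightGroup Δ, ∀ β, PrimRoot W M β →
      ∃ n : ℤ, 2 * ⟪v, β⟫ / ⟪β, β⟫ = (n : ℝ) := by
    intro v hv β hβ
    have key : ∀ x ∈ Submodule.span ℤ
        ((fun i : Φ => (2 / ⟪(i : V), (i : V)⟫) • (i : V)) '' (s : Set Φ)),
        ∃ n : ℤ, ⟪v, x⟫ = (n : ℝ) := by
      intro x hx
      induction hx using Submodule.span_induction with
      | mem x hx =>
        obtain ⟨γ, hγ, rfl⟩ := hx
        obtain ⟨i, hi⟩ : (γ : V) ∈ Set.range Δ := hrange ▸ ⟨γ, hγ, rfl⟩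
        obtain ⟨n, hn⟩ := hv i
        refine ⟨n, ?_⟩
        simp only [← hi]
        rw [← hn, real_inner_smul_right]; ring
      | zero => exact ⟨0, by simp⟩
      | add x y _ _ hx hy =>
        obtain ⟨n, hn⟩ := hx
        obtain ⟨m, hm⟩ := hy
        exact ⟨n + m, by rw [inner_add_right, hn, hm]; simp⟩
      | smul c x _ hx =>
        obtain ⟨n, hn⟩ := hx
        exact ⟨c * n, by rw [← Int.cast_smul_eq_zsmul ℝ, real_inner_smul_right, hn]; simp⟩
    obtain ⟨n, hn⟩ := key _ (h3 ⟨β, hβ⟩)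
    refine ⟨n, ?_⟩
    rw [← hn, real_inner_smul_right]; ring
  have hrefl : ∀ g : V ≃ₗ[ℝ] V, ∀ β, PrimRoot W M β → IsReflectionBy g β →
      ∀ v ∈ weightGroup Δ, g v ∈ weightGroup Δ := by
    intro g β hβ hg v hv i
    obtain ⟨n, hn⟩ := hall v hv β hβ
    obtain ⟨m, hm⟩ := hv i
    obtain ⟨k, hk⟩ := hMΛ hβ.2.1 i
    refine ⟨m - n * k, ?_⟩
    rw [hg.2, hn, inner_sub_left, real_inner_smul_left]
    push_cast
    rw [← hm, ← hk]; ring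
  refine ⟨s.card, Δ, ⟨?_, hfin.toFinset, ?_, ?_, ?_, ?_, ?_, ?_⟩, fun i => (hΔ i).2.1, hMΛ, ?_⟩
  · exact LinearIndependent.comp h1 _ s.equivFin.symm.injective
  · simpa using fun h => h0 0 h rfl
  · simp only [Set.Finite.mem_toFinset]
    rintro α hα β hβ ⟨c, hc⟩
    exact prim_red hα hβ hc
  · simp only [Set.Finite.mem_toFinset]
    exact fun α hα β hβ => prim_closed hWM hα hβ
  · simpa only [Set.Finite.mem_toFinset, Set.mem_ofPred_eq] using hWcl
  · simpa only [Set.Finite.mem_toFinset, Set.mem_ofPred_eq] using hΔ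
  · simp only [Set.Finite.mem_toFinset]
    intro α hα
    have h := h2 ⟨α, hα⟩
    rw [hrange] at h
    rcases h with h | h
    · exact Or.inl (closure_combo Δ _ h)
    · right
      obtain ⟨c, hc, h⟩ := closure_combo Δ _ h
      refine ⟨-c, fun i => by simpa using hc i, ?_⟩
      simp only [Pi.neg_apply, neg_smul, Finset.sum_neg_distrib, ← h, neg_neg]
  · intro w hw
    rw [← hWcl] at hw
    have : ∀ v ∈ weightGroup Δ, w v ∈ weightGroup Δ ∧ w⁻¹ v ∈ weightGroup Δ := by
      induction hw using Subgroup.closure_induction with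
      | mem g hg =>
        obtain ⟨β, hβ, hg⟩ := hg
        intro v hv
        have hi : g⁻¹ v = g v := by
          change g.symm v = g v
          rw [LinearEquiv.symm_apply_eq, refl_invol hg]
        rw [hi]
        exact ⟨hrefl g β hβ hg v hv, hrefl g β hβ hg v hv⟩
      | one => intro v hv; exact ⟨hv, by simpa using hv⟩
      | mul x y _ _ hx hy =>
        intro v hv
        refine ⟨(hx _ (hy v hv).1).1, ?_⟩
        rw [mul_inv_rev]
        exact (hy _ (hx v hv).2).2
      | inv x _ hx =>
        intro v hv
        rw [inv_inv]
        exact (hx v hv).symm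
    exact fun v hv => (this v hv).1
end
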